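/- arXiv:1803.01572 — 6 statements merged into one kernel-verified Lean document; each statement's English description precedes it below -/
import Mathlib

section
/- Assume the Hilbert space setting below, and assume additionally that there is C_D > 0 such that for every p ∈ W there exists w ∈ V with b(w, p) = −‖p‖_W² and C_D ‖w‖_V ≤ ‖p‖_W. Set C₁ = (1/2) · min{C_K, C_D²/E_max², 1/E_max²} and C₂ = √(2 + 2 C_D²/E_max² + 2/E_max²). Then for every (u, p, p̃) ∈ V × W × W there exists (v, q, q̃) ∈ V × W × W with |||(v, q, q̃)||| ≤ C₂ |||(u, p, p̃)||| and B(u, p, p̃; v, q, q̃) ≥ E_min C₁ |||(u, p, p̃)|||². -/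
open RealInnerProductSpace

/-- The coefficient-dependent triple norm
`|||(v, q, q̃)|||² = α ‖v‖² + (α⁻¹ + (αβ)⁻¹) ‖q‖² + (αβ)⁻¹ ‖q̃‖²`. -/
noncomputable def tripleNorm {V W : Type*} [NormedAddCommGroup V] [NormedAddCommGroup W]
    (α β : ℝ) (x : V × W × W) : ℝ :=
  Real.sqrt (α * ‖x.1‖ ^ 2 + (α⁻¹ + (α * β)⁻¹) * ‖x.2.1‖ ^ 2 + (α * β)⁻¹ * ‖x.2.2‖ ^ 2)

/-- Young's inequality for a symmetric positive-semidefinite bilinear form. -/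
theorem LinearMap.mul_apply_le_half_of_psd {V : Type*} [AddCommGroup V] [Module ℝ V]
    (a : V →ₗ[ℝ] V →ₗ[ℝ] ℝ) (symm : ∀ u v, a u v = a v u) (psd : ∀ u, 0 ≤ a u u)
    (t : ℝ) (u w : V) : t * a u w ≤ (a u u + t ^ 2 * a w w) / 2 := by
  have h := psd (u - t • w)
  simp only [map_sub, map_smul, LinearMap.sub_apply, LinearMap.smul_apply, smul_eq_mul] at h
  rw [symm w u] at h
  linarith

theorem norm_sub_smul_sq_le {V : Type*} [NormedAddCommGroup V] [InnerProductSpace ℝ V]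
    (t : ℝ) (u w : V) : ‖u - t • w‖ ^ 2 ≤ 2 * ‖u‖ ^ 2 + 2 * (t ^ 2 * ‖w‖ ^ 2) := by
  have h := parallelogram_law_with_norm ℝ u (t • w)
  have hs : ‖t • w‖ ^ 2 = t ^ 2 * ‖w‖ ^ 2 := by rw [norm_smul, mul_pow, Real.norm_eq_abs, sq_abs]
  nlinarith [sq_nonneg ‖u + t • w‖]

theorem stmt3 {V W : Type*}
    [NormedAddCommGroup V] [InnerProductSpace ℝ V] [CompleteSpace V]
    [NormedAddCommGroup W] [InnerProductSpace ℝ W] [CompleteSpace W]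
    (α β Emin Emax CK CD : ℝ)
    (hα : 0 < α) (hβ : 0 < β) (hEmin : 0 < Emin) (hE : Emin ≤ Emax)
    (hCK : 0 < CK) (hCK1 : CK ≤ 1) (hCD : 0 < CD)
    -- the elasticity form a
    (a : V →ₗ[ℝ] V →ₗ[ℝ] ℝ) (ha_symm : ∀ u v, a u v = a v u)
    (ha_psd : ∀ u, 0 ≤ a u u)
    (ha_coer : ∀ u, α * Emin * CK * ‖u‖ ^ 2 ≤ a u u)
    (ha_bdd : ∀ u v, |a u v| ≤ α * Emax * ‖u‖ * ‖v‖)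
    -- the divergence form b together with the inf-sup property
    (b : V →ₗ[ℝ] W →ₗ[ℝ] ℝ)
    (hb_infsup : ∀ p : W, ∃ w : V, b w p = -‖p‖ ^ 2 ∧ CD * ‖w‖ ≤ ‖p‖)
    -- the coupling form c
    (c : W → W → ℝ) (hc : ∀ p q, c p q = (α * β)⁻¹ * ⟪p, q⟫)
    -- the weighted mass form d
    (d : W →ₗ[ℝ] W →ₗ[ℝ] ℝ) (hd_symm : ∀ p q, d p q = d q p)
    (hd_psd : ∀ p, 0 ≤ d p p)
    (hd_coer : ∀ p, (α * β)⁻¹ * Emin * ‖p‖ ^ 2 ≤ d p p)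
    (hd_bdd : ∀ p q, |d p q| ≤ (α * β)⁻¹ * Emax * ‖p‖ * ‖q‖)
    -- the composite bilinear form B
    (B : V → W → W → V → W → W → ℝ)
    (hB : ∀ u p p' v q q', B u p p' v q q' =
      a u v + b v p + b u q - c p' q - c p q' + d p' q')
    -- the constants
    (C₁ C₂ : ℝ)
    (hC₁ : C₁ = (1 / 2) * min CK (min (CD ^ 2 / Emax ^ 2) (1 / Emax ^ 2)))
    (hC₂ : C₂ = Real.sqrt (2 + 2 * CD ^ 2 / Emax ^ 2 + 2 / Emax ^ 2)) :
    ∀ u p p', ∃ v q q',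
      tripleNorm α β (v, q, q') ≤ C₂ * tripleNorm α β (u, p, p') ∧
      Emin * C₁ * tripleNorm α β (u, p, p') ^ 2 ≤ B u p p' v q q' := by
  intro u p p'
  have hM : 0 < Emax := hEmin.trans_le hE
  obtain ⟨w, hbw, hw⟩ := hb_infsup p
  set κ : ℝ := (α * β)⁻¹ with hκ_def
  have hκ : 0 < κ := by positivity
  have hαi : 0 < α⁻¹ := by positivity
  have hw2 : CD ^ 2 * ‖w‖ ^ 2 ≤ ‖p‖ ^ 2 := by
    rw [← mul_pow]
    exact pow_le_pow_left₀ (by positivity) hw 2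
  set δ : ℝ := CD ^ 2 / (α * Emax) with hδ
  set τ : ℝ := 1 / Emax with hτ
  set K : ℝ := CD ^ 2 / Emax ^ 2 with hK
  set L : ℝ := 1 / Emax ^ 2 with hL
  have hK0 : 0 < K := by positivity
  have hL0 : 0 < L := by positivity
  have hδw : α * (δ ^ 2 * ‖w‖ ^ 2) ≤ α⁻¹ * K * ‖p‖ ^ 2 := by
    calc α * (δ ^ 2 * ‖w‖ ^ 2) = α⁻¹ * K * (CD ^ 2 * ‖w‖ ^ 2) := by
          rw [hδ, hK]; field_simp
      _ ≤ _ := by gcongr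
  have hτ2 : τ ^ 2 = L := by rw [hτ, hL]; ring
  have hδE : α⁻¹ * K * Emax = δ := by rw [hδ, hK]; field_simp
  have hτE : L * Emax = τ := by rw [hτ, hL]; field_simp
  refine ⟨u - δ • w, -p, p' - τ • p, ?_, ?_⟩
  · have hC2 : C₂ = Real.sqrt (2 + 2 * K + 2 * L) := by
      rw [hC₂, hK, hL]; congr 1; ring
    rw [hC2, tripleNorm, tripleNorm, ← Real.sqrt_mul (by positivity)]
    apply Real.sqrt_le_sqrt
    simp only [norm_neg, ← hκ_def]
    have hv := mul_le_mul_of_nonneg_left (norm_sub_smul_sq_le δ u w) hα.le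
    have hq := mul_le_mul_of_nonneg_left (norm_sub_smul_sq_le τ p' p) hκ.le
    rw [hτ2] at hq
    have e1 : 0 ≤ (2 * K + 2 * L) * (α * ‖u‖ ^ 2) := by positivity
    have e2 : 0 ≤ (2 * K + 2 * L) * (κ * ‖p'‖ ^ 2) := by positivity
    have e3 : 0 ≤ (1 + 2 * L) * (α⁻¹ * ‖p‖ ^ 2) := by positivity
    have e4 : 0 ≤ (1 + 2 * K) * (κ * ‖p‖ ^ 2) := by positivity
    linarith
  · rw [tripleNorm, Real.sq_sqrt (by positivity), hB]
    simp only [hc, map_sub, map_smul, map_neg, LinearMap.sub_apply, LinearMap.smul_apply,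
      smul_eq_mul, hbw, inner_neg_right, inner_sub_right, inner_smul_right,
      real_inner_self_eq_norm_sq, ← hκ_def]
    rw [real_inner_comm p p']
    have ha1 := LinearMap.mul_apply_le_half_of_psd a ha_symm ha_psd δ u w
    have hd1 := LinearMap.mul_apply_le_half_of_psd d hd_symm hd_psd τ p' p
    have haw : δ ^ 2 * a w w ≤ δ * ‖p‖ ^ 2 := by
      calc δ ^ 2 * a w w ≤ δ ^ 2 * (α * Emax * ‖w‖ * ‖w‖) := by
            gcongr; exact (le_abs_self _).trans (ha_bdd w w)
        _ = Emax * (α * (δ ^ 2 * ‖w‖ ^ 2)) := by ring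
        _ ≤ Emax * (α⁻¹ * K * ‖p‖ ^ 2) := by gcongr
        _ = δ * ‖p‖ ^ 2 := by rw [← hδE]; ring
    have hdp : τ ^ 2 * d p p ≤ τ * (κ * ‖p‖ ^ 2) := by
      calc τ ^ 2 * d p p ≤ τ ^ 2 * (κ * Emax * ‖p‖ * ‖p‖) := by
            gcongr; exact (le_abs_self _).trans (hd_bdd p p)
        _ = τ * (κ * ‖p‖ ^ 2) := by rw [hτ2, ← hτE]; ring
    have hm1 : C₁ ≤ CK / 2 := by
      rw [hC₁]; linarith [min_le_left CK (min K L)]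
    have hm2 : C₁ ≤ K / 2 := by
      rw [hC₁]; linarith [(min_le_right CK (min K L)).trans (min_le_left K L)]
    have hm3 : C₁ ≤ L / 2 := by
      rw [hC₁]; linarith [(min_le_right CK (min K L)).trans (min_le_right K L)]
    have f1 : Emin * C₁ * (α * ‖u‖ ^ 2) ≤ a u u / 2 := by
      calc Emin * C₁ * (α * ‖u‖ ^ 2) ≤ Emin * (CK / 2) * (α * ‖u‖ ^ 2) := by gcongr
        _ ≤ a u u / 2 := by linarith [ha_coer u]
    have f2 : Emin * C₁ * (α⁻¹ * ‖p‖ ^ 2) ≤ δ * ‖p‖ ^ 2 / 2 := by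
      calc Emin * C₁ * (α⁻¹ * ‖p‖ ^ 2) ≤ Emin * (K / 2) * (α⁻¹ * ‖p‖ ^ 2) := by gcongr
        _ ≤ Emax * (K / 2) * (α⁻¹ * ‖p‖ ^ 2) := by gcongr
        _ = δ * ‖p‖ ^ 2 / 2 := by rw [← hδE]; ring
    have f3 : Emin * C₁ * (κ * ‖p‖ ^ 2) ≤ τ * (κ * ‖p‖ ^ 2) / 2 := by
      calc Emin * C₁ * (κ * ‖p‖ ^ 2) ≤ Emin * (L / 2) * (κ * ‖p‖ ^ 2) := by gcongr
        _ ≤ Emax * (L / 2) * (κ * ‖p‖ ^ 2) := by gcongr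
        _ = τ * (κ * ‖p‖ ^ 2) / 2 := by rw [← hτE]; ring
    have f4 : Emin * C₁ * (κ * ‖p'‖ ^ 2) ≤ d p' p' / 2 := by
      calc Emin * C₁ * (κ * ‖p'‖ ^ 2) ≤ Emin * (1 / 2) * (κ * ‖p'‖ ^ 2) := by
            gcongr; linarith
        _ ≤ d p' p' / 2 := by linarith [hd_coer p']
    linarith
end

section
/- Assume the Hilbert space setting below, assume additionally that |b(v, q)| ≤ C_b ‖v‖_V ‖q‖_W for some C_b > 0 and all v ∈ V, q ∈ W, and that there is C_D > 0 such that for every p ∈ W there exists w ∈ V with b(w, p) = −‖p‖_W² and C_D ‖w‖_V ≤ ‖p‖_W. Then for every continuous linear functional f : V → ℝ there exists a unique (u, p, p̃) ∈ V × W × W such that B(u, p, p̃; v, q, q̃) = f(v) for all (v, q, q̃) ∈ V × W × W; moreover |||(u, p, p̃)||| ≤ (C₂ / (C₁ E_min)) · α^{−1/2} · ‖f‖_{V*}, where C₁ = (1/2) · min{C_K, C_D²/E_max², 1/E_max²}, C₂ = √(2 + 2 C_D²/E_max² + 2/E_max²), and ‖f‖_{V*} is the operator norm of f with respect to ‖·‖_V.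 -/
open RealInnerProductSpace

theorem exists_continuousLinearMap_inner_eq {V W : Type*}
    [NormedAddCommGroup V] [NormedSpace ℝ V]
    [NormedAddCommGroup W] [InnerProductSpace ℝ W] [CompleteSpace W]
    (b : V →ₗ[ℝ] W →ₗ[ℝ] ℝ) {C : ℝ} (hb : ∀ v q, |b v q| ≤ C * ‖v‖ * ‖q‖) :
    ∃ T : V →L[ℝ] W, ∀ v q, ⟪T v, q⟫ = b v q := by
  let B := b.mkContinuous₂ C hb
  refine ⟨LinearMap.mkContinuous
    { toFun := fun v => (InnerProductSpace.toDual ℝ W).symm (B v)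
      map_add' := by simp
      map_smul' := by simp } ‖B‖ fun v => ?_, fun v q => ?_⟩
  · simpa using B.le_opNorm v
  · simp [B]

/-- **Lax–Milgram**: a bounded coercive bilinear form represents every continuous functional. -/
theorem exists_forall_eq_of_coercive {V : Type*}
    [NormedAddCommGroup V] [InnerProductSpace ℝ V] [CompleteSpace V]
    {G : V →L[ℝ] V →L[ℝ] ℝ} (hG : IsCoercive G) (f : V →L[ℝ] ℝ) :
    ∃ u, ∀ v, G u v = f v := by
  refine ⟨hG.continuousLinearEquivOfBilin.symm ((InnerProductSpace.toDual ℝ V).symm f),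
    fun v => ?_⟩
  rw [← hG.continuousLinearEquivOfBilin_apply]
  simp

/-- The three-field system obtained by testing the weak form in each variable separately. -/
structure IsThreeFieldSolution {V W : Type*} [NormedAddCommGroup V] [InnerProductSpace ℝ V]
    [NormedAddCommGroup W] [InnerProductSpace ℝ W] (k : ℝ)
    (a : V →ₗ[ℝ] V →ₗ[ℝ] ℝ) (b : V →ₗ[ℝ] W →ₗ[ℝ] ℝ) (d : W →ₗ[ℝ] W →ₗ[ℝ] ℝ)
    (f : V →L[ℝ] ℝ) (x : V × W × W) : Prop where
  momentum : ∀ v, a x.1 v + b v x.2.1 = f v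
  strain : ∀ q, b x.1 q = k * ⟪x.2.2, q⟫
  pressure : ∀ q, d x.2.2 q = k * ⟪x.2.1, q⟫

section ThreeField

variable {V W : Type*} [NormedAddCommGroup V] [InnerProductSpace ℝ V]
  [NormedAddCommGroup W] [InnerProductSpace ℝ W]
  {a : V →ₗ[ℝ] V →ₗ[ℝ] ℝ} {b : V →ₗ[ℝ] W →ₗ[ℝ] ℝ} {d : W →ₗ[ℝ] W →ₗ[ℝ] ℝ}

theorem isThreeFieldSolution_iff {k : ℝ} {f : V →L[ℝ] ℝ} {x : V × W × W} :
    IsThreeFieldSolution k a b d f x ↔ ∀ v q q', a x.1 v + b v x.2.1 + b x.1 q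
      - k * ⟪x.2.2, q⟫ - k * ⟪x.2.1, q'⟫ + d x.2.2 q' = f v := by
  constructor
  · rintro ⟨h₁, h₂, h₃⟩ v q q'
    linarith [h₁ v, h₂ q, h₃ q']
  · refine fun h => ⟨fun v => ?_, fun q => ?_, fun q => ?_⟩
    · simpa using h v 0 0
    · have := h 0 q 0
      simp at this
      linarith
    · have := h 0 0 q
      simp at this
      linarith

theorem IsThreeFieldSolution.sub {k : ℝ} {f g : V →L[ℝ] ℝ} {x y : V × W × W}
    (hx : IsThreeFieldSolution k a b d f x) (hy : IsThreeFieldSolution k a b d g y) :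
    IsThreeFieldSolution k a b d (f - g) (x - y) where
  momentum v := by
    simp only [Prod.fst_sub, Prod.snd_sub, map_sub, LinearMap.sub_apply,
      _root_.sub_apply, ← hx.momentum v, ← hy.momentum v]
    ring
  strain q := by
    simp only [Prod.fst_sub, Prod.snd_sub, map_sub, LinearMap.sub_apply, inner_sub_left,
      hx.strain q, hy.strain q]
    ring
  pressure q := by
    simp only [Prod.fst_sub, Prod.snd_sub, map_sub, LinearMap.sub_apply, inner_sub_left,
      hx.pressure q, hy.pressure q]
    ring

/-- Eliminating both `W`-components leaves the coercive problem
`a(u, v) + k⁻² d(Tu, Tv) = f(v)` on `V`, where `T` represents `b`. -/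
theorem exists_isThreeFieldSolution [CompleteSpace V] [CompleteSpace W] {k μ Ca Cb Cd : ℝ}
    (hk : k ≠ 0) (hμ : 0 < μ)
    (ha_coer : ∀ u, μ * ‖u‖ ^ 2 ≤ a u u) (ha_bdd : ∀ u v, |a u v| ≤ Ca * ‖u‖ * ‖v‖)
    (hb_bdd : ∀ v q, |b v q| ≤ Cb * ‖v‖ * ‖q‖)
    (hd_psd : ∀ p, 0 ≤ d p p) (hd_bdd : ∀ p q, |d p q| ≤ Cd * ‖p‖ * ‖q‖)
    (f : V →L[ℝ] ℝ) : ∃ x, IsThreeFieldSolution k a b d f x := by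
  obtain ⟨T, hT⟩ := exists_continuousLinearMap_inner_eq b hb_bdd
  obtain ⟨D, hD⟩ := exists_continuousLinearMap_inner_eq d hd_bdd
  let G : V →L[ℝ] V →L[ℝ] ℝ :=
    a.mkContinuous₂ Ca ha_bdd + (k⁻¹ ^ 2) • (d.mkContinuous₂ Cd hd_bdd).bilinearComp T T
  have hG_apply (u v) : G u v = a u v + k⁻¹ ^ 2 * d (T u) (T v) := by simp [G]
  have hG : IsCoercive G := by
    refine ⟨μ, hμ, fun u => ?_⟩
    rw [hG_apply, mul_assoc, ← sq]
    exact (ha_coer u).trans (le_add_of_nonneg_right (mul_nonneg (sq_nonneg _) (hd_psd _)))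
  obtain ⟨u, hu⟩ := exists_forall_eq_of_coercive hG f
  refine ⟨(u, k⁻¹ • D (k⁻¹ • T u), k⁻¹ • T u), fun v => ?_, fun q => ?_, fun q => ?_⟩
  · rw [← hu v, hG_apply, ← hT, real_inner_comm, inner_smul_left, hD]
    simp
    ring
  · rw [inner_smul_left, hT]
    simp [hk]
  · rw [inner_smul_left, hD]
    simp [hk]

variable {α k e E CK CD m : ℝ} {f : V →L[ℝ] ℝ} {x : V × W × W}

/-- The energy estimate for the displacement and the auxiliary pressure. -/
theorem IsThreeFieldSolution.energy_le (hx : IsThreeFieldSolution k a b d f x)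
    (hα : 0 < α) (hk : 0 < k) (he : 0 < e) (hm : 0 < m) (hmK : m ≤ CK)
    (ha_coer : ∀ u, α * e * CK * ‖u‖ ^ 2 ≤ a u u)
    (hd_coer : ∀ p, k * e * ‖p‖ ^ 2 ≤ d p p) :
    α * e * m * ‖x.1‖ ≤ ‖f‖ ∧ α * e * m * a x.1 x.1 ≤ ‖f‖ ^ 2 ∧
      α * e * m * (k * e * ‖x.2.2‖ ^ 2) ≤ ‖f‖ ^ 2 := by
  obtain ⟨u, p, r⟩ := x
  have hc : 0 < α * e * m := by positivity
  have hf : f u ≤ ‖f‖ * ‖u‖ := (le_abs_self _).trans (f.le_opNorm u)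
  have hA : α * e * m * ‖u‖ ^ 2 ≤ a u u := le_trans (by gcongr) (ha_coer u)
  have hD : k * e * ‖r‖ ^ 2 ≤ d r r := hd_coer r
  have hsum : a u u + d r r = f u := by
    have h₁ := hx.momentum u
    have h₂ := hx.strain p
    have h₃ := hx.pressure r
    simp only at h₁ h₂ h₃
    rw [real_inner_comm] at h₂
    linarith
  have hA0 : 0 ≤ α * e * m * ‖u‖ ^ 2 := by positivity
  have hD0 : 0 ≤ k * e * ‖r‖ ^ 2 := by positivity
  have hu : α * e * m * ‖u‖ ≤ ‖f‖ := by
    rcases (norm_nonneg u).eq_or_lt with h | h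
    · simp [← h]
    · refine le_of_mul_le_mul_right ?_ h
      nlinarith
  have hfu : α * e * m * (‖f‖ * ‖u‖) ≤ ‖f‖ ^ 2 := by nlinarith [norm_nonneg f]
  refine ⟨hu, ?_, ?_⟩
  · exact (mul_le_mul_of_nonneg_left (by linarith) hc.le).trans hfu
  · exact (mul_le_mul_of_nonneg_left (by linarith) hc.le).trans hfu

theorem IsThreeFieldSolution.norm_pressure_le (hx : IsThreeFieldSolution k a b d f x)
    (hk : 0 < k) (hd_bdd : ∀ p q, |d p q| ≤ k * E * ‖p‖ * ‖q‖) :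
    ‖x.2.1‖ ^ 2 ≤ E ^ 2 * ‖x.2.2‖ ^ 2 := by
  obtain ⟨u, p, r⟩ := x
  have h := (le_abs_self _).trans (hd_bdd r p)
  rw [hx.pressure p, real_inner_self_eq_norm_sq] at h
  have hp : ‖p‖ ≤ E * ‖r‖ := by
    rcases (norm_nonneg p).eq_or_lt with h0 | h0
    · by_contra! hlt
      have hr : r ≠ 0 := by
        rintro rfl
        simp [← h0] at hlt
      have := (abs_nonneg _).trans (hd_bdd r r)
      have hr' : 0 < ‖r‖ := norm_pos_iff.mpr hr
      rw [← h0] at hlt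
      nlinarith [mul_pos hk hr']
    · refine le_of_mul_le_mul_left ?_ (mul_pos hk h0)
      nlinarith
  rw [← mul_pow]
  gcongr

theorem IsThreeFieldSolution.infsup_le (hx : IsThreeFieldSolution k a b d f x)
    (hα : 0 < α) (hE : 0 < E) (hCD : 0 < CD)
    (ha_symm : ∀ u v, a u v = a v u) (ha_psd : ∀ u, 0 ≤ a u u)
    (ha_bdd : ∀ u v, |a u v| ≤ α * E * ‖u‖ * ‖v‖)
    (hb_infsup : ∀ p : W, ∃ w : V, b w p = -‖p‖ ^ 2 ∧ CD * ‖w‖ ≤ ‖p‖) :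
    CD ^ 2 * ‖x.2.1‖ ^ 2 ≤ 2 * (α * E * a x.1 x.1) + 2 * ‖f‖ ^ 2 := by
  obtain ⟨u, p, r⟩ := x
  obtain ⟨w, hw, hwp⟩ := hb_infsup p
  have hcs : a u w ^ 2 ≤ a u u * a w w :=
    LinearMap.BilinForm.apply_sq_le_of_symm a ha_psd ⟨ha_symm⟩ u w
  have hww : a w w ≤ α * E * ‖w‖ ^ 2 := by
    have := (le_abs_self _).trans (ha_bdd w w)
    linarith
  have hfw : f w ^ 2 ≤ ‖f‖ ^ 2 * ‖w‖ ^ 2 := by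
    rw [← mul_pow, ← sq_abs]
    exact pow_le_pow_left₀ (abs_nonneg _) (f.le_opNorm w) 2
  have hmom : ‖p‖ ^ 2 = a u w - f w := by
    have := hx.momentum w
    simp only at this
    linarith
  have hw2 : CD ^ 2 * ‖w‖ ^ 2 ≤ ‖p‖ ^ 2 := by
    rw [← mul_pow]
    gcongr
  have hauw : a u w ^ 2 ≤ α * E * a u u * ‖w‖ ^ 2 := by
    nlinarith [mul_le_mul_of_nonneg_left hww (ha_psd u)]
  have hp4 : ‖p‖ ^ 2 * ‖p‖ ^ 2 ≤ (2 * (α * E * a u u) + 2 * ‖f‖ ^ 2) * ‖w‖ ^ 2 := by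
    rw [hmom]
    nlinarith [sq_nonneg (a u w + f w)]
  have hS : 0 ≤ 2 * (α * E * a u u) + 2 * ‖f‖ ^ 2 := by
    have := ha_psd u
    positivity
  change CD ^ 2 * ‖p‖ ^ 2 ≤ 2 * (α * E * a u u) + 2 * ‖f‖ ^ 2
  rcases (norm_nonneg p).eq_or_lt with h0 | h0
  · simpa [← h0] using hS
  · refine le_of_mul_le_mul_right ?_ (pow_pos h0 2)
    nlinarith [mul_le_mul_of_nonneg_left hp4 (sq_nonneg CD), mul_le_mul_of_nonneg_left hw2 hS]

theorem IsThreeFieldSolution.tripleNorm_sq_le (hx : IsThreeFieldSolution k a b d f x)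
    (hα : 0 < α) (hk : 0 < k) (he : 0 < e) (heE : e ≤ E) (hCD : 0 < CD) (hm : 0 < m)
    (hm1 : m ≤ 1) (hmK : m ≤ CK) (hmD : m * E ^ 2 ≤ CD ^ 2) (hmE : m * E ^ 2 ≤ 1)
    (ha_symm : ∀ u v, a u v = a v u) (ha_psd : ∀ u, 0 ≤ a u u)
    (ha_coer : ∀ u, α * e * CK * ‖u‖ ^ 2 ≤ a u u)
    (ha_bdd : ∀ u v, |a u v| ≤ α * E * ‖u‖ * ‖v‖)
    (hb_infsup : ∀ p : W, ∃ w : V, b w p = -‖p‖ ^ 2 ∧ CD * ‖w‖ ≤ ‖p‖)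
    (hd_coer : ∀ p, k * e * ‖p‖ ^ 2 ≤ d p p)
    (hd_bdd : ∀ p q, |d p q| ≤ k * E * ‖p‖ * ‖q‖) :
    α * ‖x.1‖ ^ 2 + (α⁻¹ + k) * ‖x.2.1‖ ^ 2 + k * ‖x.2.2‖ ^ 2 ≤
      7 * (‖f‖ ^ 2 / (α * e ^ 2 * m ^ 2)) := by
  have hE : 0 < E := he.trans_le heE
  obtain ⟨hu, hA, hr⟩ := hx.energy_le hα hk he hm hmK ha_coer hd_coer
  have hP := hx.norm_pressure_le hk hd_bdd
  have hQ := hx.infsup_le hα hE hCD ha_symm ha_psd ha_bdd hb_infsup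
  obtain ⟨u, p, r⟩ := x
  simp only at *
  have hU' : α * ‖u‖ ^ 2 ≤ ‖f‖ ^ 2 / (α * e ^ 2 * m ^ 2) := by
    rw [le_div_iff₀ (by positivity)]
    have := pow_le_pow_left₀ (by positivity) hu 2
    linarith
  have hR' : k * ‖r‖ ^ 2 ≤ ‖f‖ ^ 2 / (α * e ^ 2 * m ^ 2) := by
    rw [le_div_iff₀ (by positivity)]
    calc k * ‖r‖ ^ 2 * (α * e ^ 2 * m ^ 2) = m * (α * e * m * (k * e * ‖r‖ ^ 2)) := by ring
      _ ≤ 1 * ‖f‖ ^ 2 := by gcongr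
      _ = ‖f‖ ^ 2 := one_mul _
  have hP' : k * ‖p‖ ^ 2 ≤ ‖f‖ ^ 2 / (α * e ^ 2 * m ^ 2) := by
    rw [le_div_iff₀ (by positivity)]
    calc k * ‖p‖ ^ 2 * (α * e ^ 2 * m ^ 2)
        ≤ k * (E ^ 2 * ‖r‖ ^ 2) * (α * e ^ 2 * m ^ 2) := by gcongr
      _ = (m * E ^ 2) * (α * e * m * (k * e * ‖r‖ ^ 2)) := by ring
      _ ≤ 1 * ‖f‖ ^ 2 := by gcongr
      _ = ‖f‖ ^ 2 := one_mul _
  have hQ' : α⁻¹ * ‖p‖ ^ 2 ≤ 4 * (‖f‖ ^ 2 / (α * e ^ 2 * m ^ 2)) := by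
    have hemE : e * m ≤ E := by nlinarith
    have hA0 : 0 ≤ α * e * m * a u u := mul_nonneg (by positivity) (ha_psd u)
    have key : E ^ 2 * (e ^ 2 * m ^ 2 * ‖p‖ ^ 2) ≤ E ^ 2 * (4 * ‖f‖ ^ 2) := by
      calc E ^ 2 * (e ^ 2 * m ^ 2 * ‖p‖ ^ 2) = e ^ 2 * m * (m * E ^ 2 * ‖p‖ ^ 2) := by ring
        _ ≤ e ^ 2 * m * (CD ^ 2 * ‖p‖ ^ 2) := by gcongr
        _ ≤ e ^ 2 * m * (2 * (α * E * a u u) + 2 * ‖f‖ ^ 2) := by gcongr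
        _ = 2 * (e * E) * (α * e * m * a u u) + 2 * (e * (e * m)) * ‖f‖ ^ 2 := by ring
        _ ≤ 2 * (E * E) * ‖f‖ ^ 2 + 2 * (E * E) * ‖f‖ ^ 2 := by gcongr
        _ = E ^ 2 * (4 * ‖f‖ ^ 2) := by ring
    have := le_of_mul_le_mul_left key (by positivity)
    rw [← mul_div_assoc, inv_mul_eq_div, div_le_div_iff₀ hα (by positivity)]
    nlinarith
  linarith

end ThreeField


theorem stmt4 {V W : Type*}
    [NormedAddCommGroup V] [InnerProductSpace ℝ V] [CompleteSpace V]
    [NormedAddCommGroup W] [InnerProductSpace ℝ W] [CompleteSpace W]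
    (α β Emin Emax CK CD Cb : ℝ)
    (hα : 0 < α) (hβ : 0 < β) (hEmin : 0 < Emin) (hE : Emin ≤ Emax)
    (hCK : 0 < CK) (hCK1 : CK ≤ 1) (hCD : 0 < CD) (hCb : 0 < Cb)
    -- the elasticity form a
    (a : V →ₗ[ℝ] V →ₗ[ℝ] ℝ) (ha_symm : ∀ u v, a u v = a v u)
    (ha_psd : ∀ u, 0 ≤ a u u)
    (ha_coer : ∀ u, α * Emin * CK * ‖u‖ ^ 2 ≤ a u u)
    (ha_bdd : ∀ u v, |a u v| ≤ α * Emax * ‖u‖ * ‖v‖)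
    -- the divergence form b: bounded and satisfying the inf-sup property
    (b : V →ₗ[ℝ] W →ₗ[ℝ] ℝ)
    (hb_bdd : ∀ v q, |b v q| ≤ Cb * ‖v‖ * ‖q‖)
    (hb_infsup : ∀ p : W, ∃ w : V, b w p = -‖p‖ ^ 2 ∧ CD * ‖w‖ ≤ ‖p‖)
    -- the coupling form c
    (c : W → W → ℝ) (hc : ∀ p q, c p q = (α * β)⁻¹ * ⟪p, q⟫)
    -- the weighted mass form d
    (d : W →ₗ[ℝ] W →ₗ[ℝ] ℝ) (hd_symm : ∀ p q, d p q = d q p)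
    (hd_psd : ∀ p, 0 ≤ d p p)
    (hd_coer : ∀ p, (α * β)⁻¹ * Emin * ‖p‖ ^ 2 ≤ d p p)
    (hd_bdd : ∀ p q, |d p q| ≤ (α * β)⁻¹ * Emax * ‖p‖ * ‖q‖)
    -- the composite bilinear form B
    (B : V → W → W → V → W → W → ℝ)
    (hB : ∀ u p p' v q q', B u p p' v q q' =
      a u v + b v p + b u q - c p' q - c p q' + d p' q')
    -- the constants
    (C₁ C₂ : ℝ)
    (hC₁ : C₁ = (1 / 2) * min CK (min (CD ^ 2 / Emax ^ 2) (1 / Emax ^ 2)))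
    (hC₂ : C₂ = Real.sqrt (2 + 2 * CD ^ 2 / Emax ^ 2 + 2 / Emax ^ 2))
    -- the right-hand side functional
    (f : V →L[ℝ] ℝ) :
    (∃! x : V × W × W, ∀ v q q', B x.1 x.2.1 x.2.2 v q q' = f v) ∧
      ∀ x : V × W × W, (∀ v q q', B x.1 x.2.1 x.2.2 v q q' = f v) →
        tripleNorm α β x ≤ (C₂ / (C₁ * Emin)) * α ^ (-(1 : ℝ) / 2) * ‖f‖ := by
  have hE0 : 0 < Emax := hEmin.trans_le hE
  have hk : 0 < (α * β)⁻¹ := by positivity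
  have hsol {x : V × W × W} : (∀ v q q', B x.1 x.2.1 x.2.2 v q q' = f v) ↔
      IsThreeFieldSolution (α * β)⁻¹ a b d f x := by
    simp only [hB, hc, isThreeFieldSolution_iff]
  simp only [hsol]
  set m := min CK (min (CD ^ 2 / Emax ^ 2) (1 / Emax ^ 2))
  have hm : 0 < m := by positivity
  have hmK : m ≤ CK := min_le_left _ _
  have hmD : m * Emax ^ 2 ≤ CD ^ 2 := by
    rw [← le_div_iff₀ (by positivity)]
    exact (min_le_right _ _).trans (min_le_left _ _)
  have hmE : m * Emax ^ 2 ≤ 1 := by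
    rw [← le_div_iff₀ (by positivity)]
    exact (min_le_right _ _).trans (min_le_right _ _)
  have hbound {g : V →L[ℝ] ℝ} {x : V × W × W}
      (hx : IsThreeFieldSolution (α * β)⁻¹ a b d g x) :=
    hx.tripleNorm_sq_le hα hk hEmin hE hCD hm (hmK.trans hCK1) hmK hmD hmE ha_symm ha_psd
      ha_coer ha_bdd hb_infsup hd_coer hd_bdd
  refine ⟨?_, fun x hx => ?_⟩
  · obtain ⟨x, hx⟩ := exists_isThreeFieldSolution hk.ne' (by positivity) ha_coer ha_bdd hb_bdd
      hd_psd hd_bdd f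
    refine ⟨x, hx, fun y hy => ?_⟩
    have h := hbound (hy.sub hx)
    rw [sub_self, norm_zero, zero_pow two_ne_zero, zero_div, mul_zero] at h
    have h₁ : 0 ≤ α * ‖(y - x).1‖ ^ 2 := by positivity
    have h₂ : 0 ≤ (α⁻¹ + (α * β)⁻¹) * ‖(y - x).2.1‖ ^ 2 := by positivity
    have h₃ : 0 ≤ (α * β)⁻¹ * ‖(y - x).2.2‖ ^ 2 := by positivity
    have e₁ : α * ‖(y - x).1‖ ^ 2 = 0 := by linarith
    have e₂ : (α⁻¹ + (α * β)⁻¹) * ‖(y - x).2.1‖ ^ 2 = 0 := by linarith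
    have e₃ : (α * β)⁻¹ * ‖(y - x).2.2‖ ^ 2 = 0 := by linarith
    rw [mul_eq_zero_iff_left (by positivity), sq_eq_zero_iff, norm_eq_zero] at e₁ e₂ e₃
    exact sub_eq_zero.mp (Prod.ext e₁ (Prod.ext e₂ e₃))
  · have hC₁0 : 0 < C₁ := by rw [hC₁]; positivity
    have hC₂0 : 0 ≤ C₂ := by rw [hC₂]; positivity
    have hC₂2 : 2 ≤ C₂ ^ 2 := by
      rw [hC₂, Real.sq_sqrt (by positivity), add_assoc]
      exact le_add_of_nonneg_right (by positivity)
    have hα2 : (α ^ (-(1 : ℝ) / 2)) ^ 2 = α⁻¹ := by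
      rw [← Real.rpow_natCast, ← Real.rpow_mul hα.le]
      norm_num [Real.rpow_neg_one]
    refine Real.sqrt_le_iff.mpr ⟨by positivity, (hbound hx).trans ?_⟩
    rw [mul_pow, mul_pow, hα2, div_pow, hC₁]
    calc 7 * (‖f‖ ^ 2 / (α * Emin ^ 2 * m ^ 2))
        ≤ 4 * C₂ ^ 2 * (‖f‖ ^ 2 / (α * Emin ^ 2 * m ^ 2)) := by gcongr; linarith
      _ = _ := by field_simp; ring
end

section
/- Assume the Hilbert space setting below, assume additionally that |b(v, q)| ≤ C_b ‖v‖_V ‖q‖_W for some C_b > 0, and let V_h ⊆ V and W_h ⊆ W be finite-dimensional subspaces satisfying the discrete inf–sup condition: there is γ > 0 such that for every q ∈ W_h, sup_{v ∈ V_h, v ≠ 0} b(v, q)/‖v‖_V ≥ γ ‖q‖_W. Then for every continuous linear functional f : V → ℝ there exists a unique (u_h, p_h, p̃_h) ∈ V_h × W_h × W_h such that B(u_h, p_h, p̃_h; v, q, q̃) = f(v) for all (v, q, q̃) ∈ V_h × W_h × W_h; moreover |||(u_h, p_h, p̃_h)||| ≤ (C₂' / (C₁' E_min)) · α^{−1/2}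 · ‖f‖_{V*}, where C₁' = (1/2) · min{C_K, γ²/E_max², 1/E_max²} and C₂' = √(2 + 2 γ²/E_max² + 2/E_max²). -/
open RealInnerProductSpace

/-- The a priori bound of a mixed problem in terms of the energies `A` and `D`. -/
lemma sq_norms_le_of_energy_bounds {α s e E K γ m N U P R A D : ℝ}
    (hα : 0 < α) (he : 0 < e) (heE : e ≤ E) (hm : 0 < m)
    (hm1 : m ≤ 1) (hmK : m ≤ K) (hmγ : m * E ^ 2 ≤ γ ^ 2) (hmE : m * E ^ 2 ≤ 1)
    (hN : 0 ≤ N) (hU : 0 ≤ U) (hD : 0 ≤ D)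
    (hA : α * e * K * U ^ 2 ≤ A) (hR : s * e * R ^ 2 ≤ D) (hAD : A + D ≤ N * U)
    (hP : γ ^ 2 * P ^ 2 ≤ 2 * N ^ 2 + 2 * (α * E * A)) (hsP : s * P ^ 2 ≤ E * D) :
    (e * m) ^ 2 * (α * (α * U ^ 2 + (α⁻¹ + s) * P ^ 2 + s * R ^ 2)) ≤ 8 * N ^ 2 := by
  have hE : 0 < E := he.trans_le heE
  have hem : 0 < e * m := mul_pos he hm
  have hA0 : α * (e * m) * U ^ 2 ≤ A := by
    refine le_trans ?_ hA
    have : 0 ≤ α * e * U ^ 2 := by positivity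
    nlinarith
  have hA' : 0 ≤ A := le_trans (by positivity) hA0
  have hUN : e * m * (α * U) ≤ N := by
    rcases hU.eq_or_lt with h | h
    · simpa [← h] using hN
    · refine le_of_mul_le_mul_right ?_ h
      linarith
  have hNU : e * m * (α * (N * U)) ≤ N ^ 2 := by
    linarith [mul_le_mul_of_nonneg_left hUN hN]
  have hAN : e * m * (α * A) ≤ N ^ 2 := le_trans (by gcongr; linarith) hNU
  have hDN : e * m * (α * D) ≤ N ^ 2 := le_trans (by gcongr; linarith) hNU
  have hU2 : (e * m) ^ 2 * (α * U) ^ 2 ≤ N ^ 2 := by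
    rw [← mul_pow]
    gcongr
  have hR2 : (e * m) ^ 2 * (α * (s * R ^ 2)) ≤ N ^ 2 := by
    calc (e * m) ^ 2 * (α * (s * R ^ 2)) = m * (e * m * (α * (s * e * R ^ 2))) := by ring
      _ ≤ m * (e * m * (α * D)) := by gcongr
      _ ≤ 1 * (e * m * (α * D)) := by gcongr
      _ ≤ N ^ 2 := by linarith
  have hsP2 : (e * m) ^ 2 * (α * (s * P ^ 2)) ≤ N ^ 2 := by
    have h1 : e * m * E ≤ 1 := by nlinarith [mul_pos hm hE]
    calc (e * m) ^ 2 * (α * (s * P ^ 2)) ≤ (e * m) ^ 2 * (α * (E * D)) := by gcongr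
      _ = e * m * E * (e * m * (α * D)) := by ring
      _ ≤ 1 * (e * m * (α * D)) := by gcongr
      _ ≤ N ^ 2 := by linarith
  have hP2 : (e * m) ^ 2 * P ^ 2 ≤ 4 * N ^ 2 := by
    have h0 : m * E ^ 2 * P ^ 2 ≤ 2 * N ^ 2 + 2 * (α * E * A) :=
      le_trans (by gcongr) hP
    refine le_of_mul_le_mul_right ?_ hE
    calc (e * m) ^ 2 * P ^ 2 * E = e * (m ^ 2 * P ^ 2 * E) * e := by ring
      _ ≤ e * (m ^ 2 * P ^ 2 * E) * E := by gcongr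
      _ = e * m * (m * E ^ 2 * P ^ 2) := by ring
      _ ≤ e * m * (2 * N ^ 2 + 2 * (α * E * A)) := by gcongr
      _ = 2 * (e * m * N ^ 2) + 2 * (e * m * (α * A)) * E := by ring
      _ ≤ 2 * (E * 1 * N ^ 2) + 2 * N ^ 2 * E := by gcongr
      _ = 4 * N ^ 2 * E := by ring
  have hsplit : (e * m) ^ 2 * (α * (α * U ^ 2 + (α⁻¹ + s) * P ^ 2 + s * R ^ 2)) =
      (e * m) ^ 2 * (α * U) ^ 2 + (e * m) ^ 2 * P ^ 2 + (e * m) ^ 2 * (α * (s * P ^ 2)) +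
        (e * m) ^ 2 * (α * (s * R ^ 2)) := by
    field_simp
    ring
  rw [hsplit]
  linarith [sq_nonneg N]

/-- The symmetric bilinear form of the mixed problem, restricted to `Vh × Wh × Wh`. -/
noncomputable def mixedForm {V W : Type*} [NormedAddCommGroup V] [InnerProductSpace ℝ V]
    [NormedAddCommGroup W] [InnerProductSpace ℝ W] (s : ℝ) (a : V →ₗ[ℝ] V →ₗ[ℝ] ℝ)
    (b : V →ₗ[ℝ] W →ₗ[ℝ] ℝ) (d : W →ₗ[ℝ] W →ₗ[ℝ] ℝ)
    (Vh : Submodule ℝ V) (Wh : Submodule ℝ W) :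
    (Vh × Wh × Wh) →ₗ[ℝ] Module.Dual ℝ (Vh × Wh × Wh) :=
  let u := Vh.subtype ∘ₗ LinearMap.fst ℝ Vh (Wh × Wh)
  let p := Wh.subtype ∘ₗ LinearMap.fst ℝ Wh Wh ∘ₗ LinearMap.snd ℝ Vh (Wh × Wh)
  let r := Wh.subtype ∘ₗ LinearMap.snd ℝ Wh Wh ∘ₗ LinearMap.snd ℝ Vh (Wh × Wh)
  a.compl₁₂ u u + b.flip.compl₁₂ p u + b.compl₁₂ u p - s • (innerₗ W).compl₁₂ r p
    - s • (innerₗ W).compl₁₂ p r + d.compl₁₂ r r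

lemma mixedForm_apply {V W : Type*} [NormedAddCommGroup V] [InnerProductSpace ℝ V]
    [NormedAddCommGroup W] [InnerProductSpace ℝ W] (s : ℝ) (a : V →ₗ[ℝ] V →ₗ[ℝ] ℝ)
    (b : V →ₗ[ℝ] W →ₗ[ℝ] ℝ) (d : W →ₗ[ℝ] W →ₗ[ℝ] ℝ)
    (Vh : Submodule ℝ V) (Wh : Submodule ℝ W) (x y : Vh × Wh × Wh) :
    mixedForm s a b d Vh Wh x y =
      a x.1 y.1 + b y.1 x.2.1 + b x.1 y.2.1 - s * ⟪(x.2.2 : W), (y.2.1 : W)⟫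
        - s * ⟪(x.2.1 : W), (y.2.2 : W)⟫ + d x.2.2 y.2.2 := rfl

/-- The squared triple norm of a solution of the mixed problem is controlled by the data. -/
lemma sq_norms_le_of_mixed_solution {V W : Type*}
    [NormedAddCommGroup V] [InnerProductSpace ℝ V]
    [NormedAddCommGroup W] [InnerProductSpace ℝ W]
    {α s e E K γ m : ℝ} (hα : 0 < α) (hs : 0 < s) (he : 0 < e) (heE : e ≤ E) (hm : 0 < m)
    (hm1 : m ≤ 1) (hmK : m ≤ K) (hmγ : m * E ^ 2 ≤ γ ^ 2) (hmE : m * E ^ 2 ≤ 1) (hγ : 0 < γ)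
    {a : V →ₗ[ℝ] V →ₗ[ℝ] ℝ} (ha_symm : ∀ u v, a u v = a v u) (ha_psd : ∀ u, 0 ≤ a u u)
    (ha_coer : ∀ u, α * e * K * ‖u‖ ^ 2 ≤ a u u)
    (ha_bdd : ∀ u v, |a u v| ≤ α * E * ‖u‖ * ‖v‖)
    {b : V →ₗ[ℝ] W →ₗ[ℝ] ℝ}
    {d : W →ₗ[ℝ] W →ₗ[ℝ] ℝ} (hd_symm : ∀ p q, d p q = d q p) (hd_psd : ∀ p, 0 ≤ d p p)
    (hd_coer : ∀ p, s * e * ‖p‖ ^ 2 ≤ d p p)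
    (hd_bdd : ∀ p q, |d p q| ≤ s * E * ‖p‖ * ‖q‖)
    {Vh : Submodule ℝ V} {Wh : Submodule ℝ W}
    (hinfsup : ∀ q ∈ Wh, ∃ v ∈ Vh, v ≠ 0 ∧ γ * ‖q‖ ≤ b v q / ‖v‖)
    (f : V →L[ℝ] ℝ) {u : V} {p r : W} (hu : u ∈ Vh) (hp : p ∈ Wh) (hr : r ∈ Wh)
    (h : ∀ v ∈ Vh, ∀ q ∈ Wh, ∀ q' ∈ Wh,
      a u v + b v p + b u q - s * ⟪r, q⟫ - s * ⟪p, q'⟫ + d r q' = f v) :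
    (e * m) ^ 2 * (α * (α * ‖u‖ ^ 2 + (α⁻¹ + s) * ‖p‖ ^ 2 + s * ‖r‖ ^ 2)) ≤
      8 * ‖f‖ ^ 2 := by
  have hE : 0 < E := he.trans_le heE
  have hcsa (u v : V) : a u v ^ 2 ≤ a u u * a v v :=
    LinearMap.BilinForm.apply_sq_le_of_symm a ha_psd ⟨ha_symm⟩ u v
  have hcsd (p q : W) : d p q ^ 2 ≤ d p p * d q q :=
    LinearMap.BilinForm.apply_sq_le_of_symm d hd_psd ⟨hd_symm⟩ p q
  have hmom (v : V) (hv : v ∈ Vh) : a u v + b v p = f v := by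
    simpa using h v hv 0 Wh.zero_mem 0 Wh.zero_mem
  have hAD : a u u + d r r ≤ ‖f‖ * ‖u‖ := by
    have h1 := h u hu (-p) (Wh.neg_mem hp) r hr
    simp only [map_neg, inner_neg_right] at h1
    rw [real_inner_comm r p] at h1
    have h2 := (le_abs_self _).trans (f.le_opNorm u)
    linarith
  have hP : γ ^ 2 * ‖p‖ ^ 2 ≤ 2 * ‖f‖ ^ 2 + 2 * (α * E * a u u) := by
    obtain ⟨v, hv, hv0, hle⟩ := hinfsup p hp
    have hvn : 0 < ‖v‖ := norm_pos_iff.mpr hv0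
    rw [le_div_iff₀ hvn] at hle
    have h1 := hmom v hv
    have hf2 : f v ^ 2 ≤ ‖f‖ ^ 2 * ‖v‖ ^ 2 := by
      rw [← mul_pow]
      exact sq_le_sq.mpr ((f.le_opNorm v).trans (le_abs_self _))
    have ha2 : a u v ^ 2 ≤ a u u * (α * E * ‖v‖ ^ 2) := by
      refine (hcsa u v).trans (mul_le_mul_of_nonneg_left ?_ (ha_psd u))
      have := (le_abs_self _).trans (ha_bdd v v)
      linarith
    have hb2 : (γ * ‖p‖ * ‖v‖) ^ 2 ≤ (b v p) ^ 2 := by gcongr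
    have hb3 : (b v p) ^ 2 ≤ 2 * f v ^ 2 + 2 * a u v ^ 2 := by
      rw [eq_sub_of_add_eq' h1]
      nlinarith [sq_nonneg (f v + a u v)]
    refine le_of_mul_le_mul_right ?_ (pow_pos hvn 2)
    linarith
  have hsP : s * ‖p‖ ^ 2 ≤ E * d r r := by
    have h1 : s * ‖p‖ ^ 2 = d r p := by
      have h2 := h 0 Vh.zero_mem 0 Wh.zero_mem p hp
      simp only [map_zero, LinearMap.zero_apply, inner_zero_right,
        real_inner_self_eq_norm_sq] at h2
      linarith
    have h2 : (s * ‖p‖ ^ 2) ^ 2 ≤ d r r * (s * E * ‖p‖ ^ 2) := by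
      rw [h1]
      refine (hcsd r p).trans (mul_le_mul_of_nonneg_left ?_ (hd_psd r))
      have := (le_abs_self _).trans (hd_bdd p p)
      linarith
    rcases (norm_nonneg p).eq_or_lt with h0 | h0
    · rw [← h0]
      have := mul_nonneg hE.le (hd_psd r)
      simpa using this
    · refine le_of_mul_le_mul_right ?_ (mul_pos hs (pow_pos h0 2))
      linarith
  exact sq_norms_le_of_energy_bounds hα he heE hm hm1 hmK hmγ hmE (norm_nonneg f)
    (norm_nonneg u) (hd_psd r) (ha_coer u) (hd_coer r) hAD hP hsP

theorem stmt5 {V W : Type*}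
    [NormedAddCommGroup V] [InnerProductSpace ℝ V] [CompleteSpace V]
    [NormedAddCommGroup W] [InnerProductSpace ℝ W] [CompleteSpace W]
    (α β Emin Emax CK Cb : ℝ)
    (hα : 0 < α) (hβ : 0 < β) (hEmin : 0 < Emin) (hE : Emin ≤ Emax)
    (hCK : 0 < CK) (hCK1 : CK ≤ 1) (hCb : 0 < Cb)
    -- the elasticity form a
    (a : V →ₗ[ℝ] V →ₗ[ℝ] ℝ) (ha_symm : ∀ u v, a u v = a v u)
    (ha_psd : ∀ u, 0 ≤ a u u)
    (ha_coer : ∀ u, α * Emin * CK * ‖u‖ ^ 2 ≤ a u u)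
    (ha_bdd : ∀ u v, |a u v| ≤ α * Emax * ‖u‖ * ‖v‖)
    -- the divergence form b, bounded
    (b : V →ₗ[ℝ] W →ₗ[ℝ] ℝ)
    (hb_bdd : ∀ v q, |b v q| ≤ Cb * ‖v‖ * ‖q‖)
    -- the coupling form c
    (c : W → W → ℝ) (hc : ∀ p q, c p q = (α * β)⁻¹ * ⟪p, q⟫)
    -- the weighted mass form d
    (d : W →ₗ[ℝ] W →ₗ[ℝ] ℝ) (hd_symm : ∀ p q, d p q = d q p)
    (hd_psd : ∀ p, 0 ≤ d p p)
    (hd_coer : ∀ p, (α * β)⁻¹ * Emin * ‖p‖ ^ 2 ≤ d p p)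
    (hd_bdd : ∀ p q, |d p q| ≤ (α * β)⁻¹ * Emax * ‖p‖ * ‖q‖)
    -- the composite bilinear form B
    (B : V → W → W → V → W → W → ℝ)
    (hB : ∀ u p p' v q q', B u p p' v q q' =
      a u v + b v p + b u q - c p' q - c p q' + d p' q')
    -- the finite-dimensional subspaces and the discrete inf-sup condition
    (Vh : Submodule ℝ V) (Wh : Submodule ℝ W)
    (hVh : FiniteDimensional ℝ Vh) (hWh : FiniteDimensional ℝ Wh)
    (γ : ℝ) (hγ : 0 < γ)
    (hinfsup : ∀ q ∈ Wh, ∃ v ∈ Vh, v ≠ 0 ∧ γ * ‖q‖ ≤ b v q / ‖v‖)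
    -- the constants
    (C₁' C₂' : ℝ)
    (hC₁' : C₁' = (1 / 2) * min CK (min (γ ^ 2 / Emax ^ 2) (1 / Emax ^ 2)))
    (hC₂' : C₂' = Real.sqrt (2 + 2 * γ ^ 2 / Emax ^ 2 + 2 / Emax ^ 2))
    -- the right-hand side functional
    (f : V →L[ℝ] ℝ) :
    (∃! x : V × W × W, x.1 ∈ Vh ∧ x.2.1 ∈ Wh ∧ x.2.2 ∈ Wh ∧
      ∀ v ∈ Vh, ∀ q ∈ Wh, ∀ q' ∈ Wh, B x.1 x.2.1 x.2.2 v q q' = f v) ∧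
      ∀ x : V × W × W, (x.1 ∈ Vh ∧ x.2.1 ∈ Wh ∧ x.2.2 ∈ Wh ∧
          ∀ v ∈ Vh, ∀ q ∈ Wh, ∀ q' ∈ Wh, B x.1 x.2.1 x.2.2 v q q' = f v) →
        tripleNorm α β x ≤ (C₂' / (C₁' * Emin)) * α ^ (-(1 : ℝ) / 2) * ‖f‖ := by
  have hEmax : 0 < Emax := hEmin.trans_le hE
  have hs : 0 < (α * β)⁻¹ := by positivity
  obtain ⟨m, hm_def⟩ : ∃ m, m = min CK (min (γ ^ 2 / Emax ^ 2) (1 / Emax ^ 2)) := ⟨_, rfl⟩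
  have hm : 0 < m := by
    rw [hm_def]
    positivity
  have hmK : m ≤ CK := hm_def ▸ min_le_left _ _
  have hmγ : m * Emax ^ 2 ≤ γ ^ 2 := by
    rw [← le_div_iff₀ (by positivity), hm_def]
    exact (min_le_right _ _).trans (min_le_left _ _)
  have hmE : m * Emax ^ 2 ≤ 1 := by
    rw [← le_div_iff₀ (by positivity), hm_def]
    exact (min_le_right _ _).trans (min_le_right _ _)
  simp only [hB, hc]
  have key (g : V →L[ℝ] ℝ) {u : V} {p r : W} (hu : u ∈ Vh) (hp : p ∈ Wh) (hr : r ∈ Wh)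
      (h : ∀ v ∈ Vh, ∀ q ∈ Wh, ∀ q' ∈ Wh, a u v + b v p + b u q - (α * β)⁻¹ * ⟪r, q⟫
        - (α * β)⁻¹ * ⟪p, q'⟫ + d r q' = g v) :=
    sq_norms_le_of_mixed_solution hα hs hEmin hE hm (hmK.trans hCK1) hmK hmγ hmE hγ
      ha_symm ha_psd ha_coer ha_bdd hd_symm hd_psd hd_coer hd_bdd hinfsup g hu hp hr h
  have hinj : Function.Injective (mixedForm (α * β)⁻¹ a b d Vh Wh) := by
    rw [injective_iff_map_eq_zero]
    rintro ⟨⟨u, hu⟩, ⟨p, hp⟩, ⟨r, hr⟩⟩ hx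
    have h1 := key 0 hu hp hr fun v hv q hq q' hq' => by
      have h2 := LinearMap.congr_fun hx (⟨v, hv⟩, ⟨q, hq⟩, ⟨q', hq'⟩)
      rwa [mixedForm_apply] at h2
    have h3 : α * ‖u‖ ^ 2 + (α⁻¹ + (α * β)⁻¹) * ‖p‖ ^ 2 + (α * β)⁻¹ * ‖r‖ ^ 2 ≤ 0 := by
      refine le_of_mul_le_mul_left (a := (Emin * m) ^ 2 * α) ?_ (by positivity)
      rw [mul_assoc, mul_zero]
      simpa only [norm_zero, ne_eq, OfNat.ofNat_ne_zero, not_false_eq_true, zero_pow,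
        mul_zero] using h1
    have hu0 : 0 ≤ α * ‖u‖ ^ 2 := by positivity
    have hp0 : 0 ≤ (α⁻¹ + (α * β)⁻¹) * ‖p‖ ^ 2 := by positivity
    have hr0 : 0 ≤ (α * β)⁻¹ * ‖r‖ ^ 2 := by positivity
    have hu1 : α * ‖u‖ ^ 2 = 0 := by linarith
    have hp1 : (α⁻¹ + (α * β)⁻¹) * ‖p‖ ^ 2 = 0 := by linarith
    have hr1 : (α * β)⁻¹ * ‖r‖ ^ 2 = 0 := by linarith
    have hαs : α⁻¹ + (α * β)⁻¹ ≠ 0 := by positivity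
    have hu2 : u = 0 := by simpa [hα.ne'] using hu1
    have hp2 : p = 0 := by simpa only [mul_eq_zero, hαs, false_or, sq_eq_zero_iff,
      norm_eq_zero] using hp1
    have hr2 : r = 0 := by simpa [hα.ne', hβ.ne'] using hr1
    subst hu2 hp2 hr2
    rfl
  have hsurj : Function.Surjective (mixedForm (α * β)⁻¹ a b d Vh Wh) :=
    (LinearMap.injective_iff_surjective_of_finrank_eq_finrank
      Subspace.dual_finrank_eq.symm).mp hinj
  refine ⟨?_, ?_⟩
  · obtain ⟨x, hx⟩ := hsurj (f.toLinearMap ∘ₗ Vh.subtype ∘ₗ LinearMap.fst ℝ Vh (Wh × Wh))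
    refine ⟨(x.1, x.2.1, x.2.2), ⟨x.1.2, x.2.1.2, x.2.2.2, fun v hv q hq q' hq' => ?_⟩, ?_⟩
    · have h2 := LinearMap.congr_fun hx (⟨v, hv⟩, ⟨q, hq⟩, ⟨q', hq'⟩)
      rwa [mixedForm_apply] at h2
    · rintro ⟨u, p, r⟩ ⟨hu, hp, hr, h⟩
      have hxy : ((⟨u, hu⟩, ⟨p, hp⟩, ⟨r, hr⟩) : Vh × Wh × Wh) = x := by
        refine hinj (LinearMap.ext fun y => ?_)
        rw [hx, mixedForm_apply]
        exact h y.1 y.1.2 y.2.1 y.2.1.2 y.2.2 y.2.2.2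
      rw [← hxy]
  · rintro ⟨u, p, r⟩ ⟨hu, hp, hr, h⟩
    have h1 := key f hu hp hr h
    have hC₁ : 0 < C₁' := by
      rw [hC₁', ← hm_def]
      positivity
    have hC₂ : 0 ≤ C₂' := hC₂' ▸ Real.sqrt_nonneg _
    have hC₂sq : 2 ≤ C₂' ^ 2 := by
      rw [hC₂', Real.sq_sqrt (by positivity)]
      have : 0 ≤ 2 * γ ^ 2 / Emax ^ 2 + 2 / Emax ^ 2 := by positivity
      linarith
    have hpow : (α ^ (-(1 : ℝ) / 2)) ^ 2 = α⁻¹ := by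
      rw [← Real.rpow_natCast, ← Real.rpow_mul hα.le, ← Real.rpow_neg_one]
      norm_num
    refine Real.sqrt_le_iff.mpr ⟨by positivity, ?_⟩
    rw [mul_pow, mul_pow, div_pow, hpow, hC₁', ← hm_def]
    refine le_of_mul_le_mul_left (a := (Emin * m) ^ 2 * α) ?_ (by positivity)
    have hrhs : (Emin * m) ^ 2 * α *
        (C₂' ^ 2 / (1 / 2 * m * Emin) ^ 2 * α⁻¹ * ‖f‖ ^ 2) = 4 * C₂' ^ 2 * ‖f‖ ^ 2 := by
      field_simp
      ring
    rw [hrhs, mul_assoc]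
    refine h1.trans ?_
    gcongr
    linarith
end

section
/- Let (Ω, μ) be a measure space, k ≥ 1, and let g₁, …, g_n : Ω → ℝ^k be measurable with ∫_Ω |g_i|² dμ < ∞ for each i. Let E, e₀ : Ω → ℝ be measurable with 0 < E_min ≤ E(ω) ≤ E_max < ∞ and 0 < e₀^{min} ≤ e₀(ω) ≤ e₀^{max} < ∞ for μ-a.e. ω. Define the Gram matrices [M_E]_{ij} = ∫_Ω E ⟨g_i, g_j⟩ dμ and [M_{e₀}]_{ij} = ∫_Ω e₀ ⟨g_i, g_j⟩ dμ, and assume M_{e₀} is positive definite. Then every eigenvalue of M_{e₀}⁻¹ M_E is real and lies in the interval [E_min / e₀^{max}, E_max / e₀^{min}]. -/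
open MeasureTheory Matrix

section WeightedGram

variable {Ω ι κ : Type*} [MeasurableSpace Ω] {μ : Measure Ω} [Fintype κ]

/-- Square-integrable vector fields have integrable weighted inner products, for every
essentially bounded weight. -/
lemma integrable_weight_mul_sum_mul {g : ι → Ω → κ → ℝ}
    (hg : ∀ i l, Measurable fun ω => g i ω l)
    (hgint : ∀ i, Integrable (fun ω => ∑ l, (g i ω l) ^ 2) μ)
    {w : Ω → ℝ} (hw : Measurable w) {B : ℝ} (hB : ∀ᵐ ω ∂μ, |w ω| ≤ B) (i j : ι) :
    Integrable (fun ω => w ω * ∑ l, g i ω l * g j ω l) μ := by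
  refine Integrable.bdd_mul (c := B) ?_ hw.aestronglyMeasurable hB
  refine ((hgint i).add (hgint j)).mono' ?_ (ae_of_all _ fun ω => ?_)
  · exact (Finset.measurable_sum _ fun l _ => (hg i l).mul (hg j l)).aestronglyMeasurable
  · refine (Finset.abs_sum_le_sum_abs _ _).trans ?_
    rw [Pi.add_apply, ← Finset.sum_add_distrib]
    refine Finset.sum_le_sum fun l _ => ?_
    rw [abs_le]
    constructor <;>
      nlinarith [sq_nonneg (g i ω l + g j ω l), sq_nonneg (g i ω l - g j ω l),
        sq_nonneg (g i ω l), sq_nonneg (g j ω l)]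

variable [Fintype ι]

lemma weight_mul_sum_sq_eq_sum_sum (g : ι → κ → ℝ) (w : ℝ) (x : ι → ℝ) :
    w * ∑ l, (∑ i, x i * g i l) ^ 2
      = ∑ i, ∑ j, x i * x j * (w * ∑ l, g i l * g j l) := by
  simp only [sq, Finset.sum_mul_sum]
  simp only [Finset.mul_sum]
  rw [Finset.sum_comm]
  refine Finset.sum_congr rfl fun i _ => ?_
  rw [Finset.sum_comm]
  refine Finset.sum_congr rfl fun j _ => Finset.sum_congr rfl fun l _ => ?_
  ring

lemma integrable_weight_mul_sum_sq {g : ι → Ω → κ → ℝ} {w : Ω → ℝ}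
    (hint : ∀ i j, Integrable (fun ω => w ω * ∑ l, g i ω l * g j ω l) μ) (x : ι → ℝ) :
    Integrable (fun ω => w ω * ∑ l, (∑ i, x i * g i ω l) ^ 2) μ := by
  simp only [fun ω => weight_mul_sum_sq_eq_sum_sum (fun i => g i ω) (w ω) x]
  exact integrable_finsetSum _ fun i _ => integrable_finsetSum _ fun j _ =>
    (hint i j).const_mul _

/-- The quadratic form of a weighted Gram matrix. -/
lemma dotProduct_mulVec_gram {g : ι → Ω → κ → ℝ} {w : Ω → ℝ}
    (hint : ∀ i j, Integrable (fun ω => w ω * ∑ l, g i ω l * g j ω l) μ)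
    {M : Matrix ι ι ℝ} (hM : ∀ i j, M i j = ∫ ω, w ω * ∑ l, g i ω l * g j ω l ∂μ)
    (x : ι → ℝ) :
    x ⬝ᵥ M *ᵥ x = ∫ ω, w ω * ∑ l, (∑ i, x i * g i ω l) ^ 2 ∂μ := by
  simp only [fun ω => weight_mul_sum_sq_eq_sum_sum (fun i => g i ω) (w ω) x]
  rw [integral_finsetSum _ fun i _ => integrable_finsetSum _ fun j _ =>
    (hint i j).const_mul _]
  simp only [dotProduct, mulVec]
  refine Finset.sum_congr rfl fun i _ => ?_
  rw [Finset.mul_sum, integral_finsetSum _ fun j _ => (hint i j).const_mul _]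
  refine Finset.sum_congr rfl fun j _ => ?_
  rw [integral_const_mul, hM]
  ring

/-- Weighted Gram matrices are monotone in the weight, as quadratic forms. -/
lemma mul_dotProduct_mulVec_gram_le {g : ι → Ω → κ → ℝ} {w₁ w₂ : Ω → ℝ}
    (hint₁ : ∀ i j, Integrable (fun ω => w₁ ω * ∑ l, g i ω l * g j ω l) μ)
    (hint₂ : ∀ i j, Integrable (fun ω => w₂ ω * ∑ l, g i ω l * g j ω l) μ)
    {M₁ M₂ : Matrix ι ι ℝ}
    (hM₁ : ∀ i j, M₁ i j = ∫ ω, w₁ ω * ∑ l, g i ω l * g j ω l ∂μ)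
    (hM₂ : ∀ i j, M₂ i j = ∫ ω, w₂ ω * ∑ l, g i ω l * g j ω l ∂μ)
    {c₁ c₂ : ℝ} (hle : ∀ᵐ ω ∂μ, c₁ * w₁ ω ≤ c₂ * w₂ ω) (x : ι → ℝ) :
    c₁ * (x ⬝ᵥ M₁ *ᵥ x) ≤ c₂ * (x ⬝ᵥ M₂ *ᵥ x) := by
  rw [dotProduct_mulVec_gram hint₁ hM₁, dotProduct_mulVec_gram hint₂ hM₂,
    ← integral_const_mul, ← integral_const_mul]
  refine integral_mono_ae ((integrable_weight_mul_sum_sq hint₁ x).const_mul _)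
    ((integrable_weight_mul_sum_sq hint₂ x).const_mul _) ?_
  filter_upwards [hle] with ω hω
  rw [← mul_assoc, ← mul_assoc]
  exact mul_le_mul_of_nonneg_right hω (Finset.sum_nonneg fun l _ => sq_nonneg _)

end WeightedGram

/-- A complex eigenvalue of `N⁻¹ * M`, with `M` real symmetric and `N` real positive definite, is
real and is the quotient of a value of the quadratic form of `M` by one of `N`. -/
lemma Matrix.PosDef.eigenvalue_inv_mul {ι : Type*} [Fintype ι] [DecidableEq ι]
    {M N : Matrix ι ι ℝ} (hM : M.IsSymm) (hN : N.PosDef) {lam : ℂ} {v : ι → ℂ} (hv : v ≠ 0)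
    (heig : ((N⁻¹ * M).map Complex.ofReal).mulVec v = lam • v) :
    lam.im = 0 ∧ ∃ a b : ι → ℝ, 0 < a ⬝ᵥ N *ᵥ a + b ⬝ᵥ N *ᵥ b ∧
      a ⬝ᵥ M *ᵥ a + b ⬝ᵥ M *ᵥ b = lam.re * (a ⬝ᵥ N *ᵥ a + b ⬝ᵥ N *ᵥ b) := by
  set a : ι → ℝ := fun i => (v i).re with ha
  set b : ι → ℝ := fun i => (v i).im with hb
  have hsymm : ∀ {A : Matrix ι ι ℝ}, A.IsSymm → a ⬝ᵥ A *ᵥ b = b ⬝ᵥ A *ᵥ a := by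
    intro A hA
    rw [dotProduct_mulVec, ← mulVec_transpose, hA.eq, dotProduct_comm]
  have hNsymm : N.IsSymm := by simpa [IsHermitian, IsSymm] using hN.isHermitian
  have hpos : ∀ x : ι → ℝ, x ≠ 0 → 0 < x ⬝ᵥ N *ᵥ x := fun x hx => by
    simpa using hN.dotProduct_mulVec_pos hx
  have hnn : ∀ x : ι → ℝ, 0 ≤ x ⬝ᵥ N *ᵥ x := fun x => by
    simpa using hN.posSemidef.dotProduct_mulVec_nonneg x
  have hNab : 0 < a ⬝ᵥ N *ᵥ a + b ⬝ᵥ N *ᵥ b := by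
    by_cases h : a = 0
    · refine add_pos_of_nonneg_of_pos (hnn a) (hpos b fun h' => hv ?_)
      funext i
      exact Complex.ext (congrFun h i) (congrFun h' i)
    · exact add_pos_of_pos_of_nonneg (hpos a h) (hnn b)
  have hcancel : N * (N⁻¹ * M) = M :=
    mul_nonsing_inv_cancel_left _ _ ((isUnit_iff_isUnit_det N).mp hN.isUnit)
  have hre : (N⁻¹ * M) *ᵥ a = lam.re • a - lam.im • b := by
    funext i
    simpa [mulVec, dotProduct, Complex.re_sum, ha, hb] using congrArg Complex.re (congrFun heig i)
  have him : (N⁻¹ * M) *ᵥ b = lam.re • b + lam.im • a := by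
    funext i
    simpa [mulVec, dotProduct, Complex.im_sum, ha, hb] using congrArg Complex.im (congrFun heig i)
  have hMa : M *ᵥ a = lam.re • N *ᵥ a - lam.im • N *ᵥ b := by
    rw [← mulVec_smul, ← mulVec_smul, ← mulVec_sub, ← hre, mulVec_mulVec, hcancel]
  have hMb : M *ᵥ b = lam.re • N *ᵥ b + lam.im • N *ᵥ a := by
    rw [← mulVec_smul, ← mulVec_smul, ← mulVec_add, ← him, mulVec_mulVec, hcancel]
  have hMab := hsymm hM
  have hNsw := hsymm hNsymm
  have hlam : lam.im = 0 := by
    rw [hMa, hMb] at hMab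
    simp only [dotProduct_add, dotProduct_sub, dotProduct_smul, smul_eq_mul, hNsw] at hMab
    exact (mul_eq_zero.mp (by linarith :
      lam.im * (a ⬝ᵥ N *ᵥ a + b ⬝ᵥ N *ᵥ b) = 0)).resolve_right hNab.ne'
  refine ⟨hlam, a, b, hNab, ?_⟩
  rw [hMa, hMb, hlam]
  simp only [zero_smul, sub_zero, add_zero, dotProduct_smul, smul_eq_mul]
  ring




theorem stmt10 {Ω : Type*} [MeasurableSpace Ω] (μ : Measure Ω)
    (k n : ℕ) (hk : 1 ≤ k)
    (g : Fin n → Ω → Fin k → ℝ)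
    (hg : ∀ i l, Measurable fun ω => g i ω l)
    (hgint : ∀ i, Integrable (fun ω => ∑ l, (g i ω l) ^ 2) μ)
    (E e₀ : Ω → ℝ) (hE : Measurable E) (he₀ : Measurable e₀)
    (Emin Emax e₀min e₀max : ℝ) (hEmin : 0 < Emin) (he₀min : 0 < e₀min)
    (hbdE : ∀ᵐ ω ∂μ, Emin ≤ E ω ∧ E ω ≤ Emax)
    (hbde₀ : ∀ᵐ ω ∂μ, e₀min ≤ e₀ ω ∧ e₀ ω ≤ e₀max)
    (ME Me₀ : Matrix (Fin n) (Fin n) ℝ)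
    (hME : ∀ i j, ME i j = ∫ ω, E ω * ∑ l, g i ω l * g j ω l ∂μ)
    (hMe₀ : ∀ i j, Me₀ i j = ∫ ω, e₀ ω * ∑ l, g i ω l * g j ω l ∂μ)
    (hpd : Me₀.PosDef)
    (lam : ℂ) (v : Fin n → ℂ) (hv : v ≠ 0)
    (heig : ((Me₀⁻¹ * ME).map Complex.ofReal).mulVec v = lam • v) :
    lam.im = 0 ∧ Emin / e₀max ≤ lam.re ∧ lam.re ≤ Emax / e₀min := by
  have hiE := integrable_weight_mul_sum_mul hg hgint hE (B := Emax) <| by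
    filter_upwards [hbdE] with ω h
    exact abs_le.mpr ⟨by linarith, h.2⟩
  have hie₀ := integrable_weight_mul_sum_mul hg hgint he₀ (B := e₀max) <| by
    filter_upwards [hbde₀] with ω h
    exact abs_le.mpr ⟨by linarith, h.2⟩
  have hsymm : ME.IsSymm := IsSymm.ext fun i j => by
    simp only [hME, mul_comm (g i _ _)]
  obtain ⟨him, a, b, hpos, hab⟩ := hpd.eigenvalue_inv_mul hsymm hv heig
  have : NeZero μ := ⟨by
    rintro rfl
    have hzero : Me₀ = 0 := by
      ext i j
      simp [hMe₀]
    simp [hzero] at hpos⟩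
  obtain ⟨ω₀, hω₀⟩ := (hbde₀.and hbdE).exists
  have he₀max : 0 < e₀max := by linarith [hω₀.1.1, hω₀.1.2]
  have hEmax : 0 < Emax := by linarith [hω₀.2.1, hω₀.2.2]
  have hlower := mul_dotProduct_mulVec_gram_le hie₀ hiE hMe₀ hME (c₁ := Emin) (c₂ := e₀max) <| by
    filter_upwards [hbdE, hbde₀] with ω h h₀
    nlinarith
  have hupper := mul_dotProduct_mulVec_gram_le hiE hie₀ hME hMe₀ (c₁ := e₀min) (c₂ := Emax) <| by
    filter_upwards [hbdE, hbde₀] with ω h h₀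
    nlinarith
  refine ⟨him, ?_, ?_⟩
  · rw [div_le_iff₀ he₀max]
    refine le_of_mul_le_mul_right ?_ hpos
    linear_combination hlower a + hlower b + e₀max * hab
  · rw [le_div_iff₀ he₀min]
    refine le_of_mul_le_mul_right ?_ hpos
    linear_combination hupper a + hupper b - e₀min * hab
end

section
/- Let (Ω, μ) be a measure space, d ≥ 1, and let G₁, …, G_n : Ω → Matrix (Fin d) (Fin d) ℝ be measurable with ∫_Ω ‖G_i‖_F² dμ < ∞ for each i, where ‖·‖_F is the Frobenius norm and M : N the Frobenius inner product; write sym(M) = (M + Mᵀ)/2. Let E, e₀ : Ω → ℝ be measurable with 0 < E_min ≤ E ≤ E_max and 0 < e₀^{min} ≤ e₀ ≤ e₀^{max} μ-a.e. Assume the Korn-type inequality: there is C_K ∈ (0, 1] such that for every v ∈ ℝⁿ, writing G_v = Σᵢ vᵢ G_i, we have ∫_Ω ‖sym(G_v)‖_F² dμ ≥ C_K ∫_Ω ‖G_v‖_F² dμ. Define [A]_{ij} = ∫_Ω E · sym(G_i) : sym(G_j) dμ and [Ã]_{ij} = ∫_Ω e₀ · G_i : G_j dμ, and assume Ã is positive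 definite. Then every eigenvalue of Ã⁻¹ A is real and lies in [C_K · E_min / e₀^{max}, E_max / e₀^{min}]. -/
open MeasureTheory Matrix

/-- Frobenius inner product of two square matrices. -/
def frobInner {d : ℕ} (M N : Matrix (Fin d) (Fin d) ℝ) : ℝ :=
  ∑ i, ∑ j, M i j * N i j

/-- Symmetric part of a square matrix. -/
noncomputable def symPart {d : ℕ} (M : Matrix (Fin d) (Fin d) ℝ) :
    Matrix (Fin d) (Fin d) ℝ :=
  (2 : ℝ)⁻¹ • (M + M.transpose)

lemma frobInner_self_nonneg {d : ℕ} (M : Matrix (Fin d) (Fin d) ℝ) : 0 ≤ frobInner M M :=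
  Finset.sum_nonneg fun _ _ => Finset.sum_nonneg fun _ _ => mul_self_nonneg _

lemma sq_entry_le_frobInner_self {d : ℕ} (M : Matrix (Fin d) (Fin d) ℝ) (r s : Fin d) :
    M r s ^ 2 ≤ frobInner M M := by
  have h₁ : M r s * M r s ≤ ∑ j, M r j * M r j :=
    Finset.single_le_sum (f := fun j => M r j * M r j) (fun _ _ => mul_self_nonneg _)
      (Finset.mem_univ s)
  have h₂ : ∑ j, M r j * M r j ≤ frobInner M M :=
    Finset.single_le_sum (f := fun i => ∑ j, M i j * M i j)
      (fun _ _ => Finset.sum_nonneg fun _ _ => mul_self_nonneg _) (Finset.mem_univ r)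
  rw [sq]
  exact h₁.trans h₂

lemma frobInner_comm {d : ℕ} (M N : Matrix (Fin d) (Fin d) ℝ) :
    frobInner M N = frobInner N M := by
  simp only [frobInner, mul_comm]

lemma frobInner_symPart_self_le {d : ℕ} (M : Matrix (Fin d) (Fin d) ℝ) :
    frobInner (symPart M) (symPart M) ≤ frobInner M M := by
  have hswap : ∑ i, ∑ j, M j i * M j i = frobInner M M := Finset.sum_comm
  have hle : frobInner (symPart M) (symPart M) ≤
      ∑ i, ∑ j, (2⁻¹ * (M i j * M i j) + 2⁻¹ * (M j i * M j i)) := by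
    refine Finset.sum_le_sum fun i _ => Finset.sum_le_sum fun j _ => ?_
    simp only [symPart, Matrix.smul_apply, Matrix.add_apply, Matrix.transpose_apply, smul_eq_mul]
    nlinarith [sq_nonneg (M i j - M j i)]
  simp only [Finset.sum_add_distrib, ← Finset.mul_sum] at hle
  rw [hswap] at hle
  change _ ≤ 2⁻¹ * frobInner M M + _ at hle
  linarith

lemma symPart_sum_smul {d n : ℕ} (v : Fin n → ℝ) (M : Fin n → Matrix (Fin d) (Fin d) ℝ) :
    symPart (∑ i, v i • M i) = ∑ i, v i • symPart (M i) := by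
  simp only [symPart, Matrix.transpose_sum, Matrix.transpose_smul, ← Finset.sum_add_distrib,
    Finset.smul_sum, ← smul_add]
  exact Finset.sum_congr rfl fun i _ => smul_comm _ _ _

lemma frobInner_sum_smul_self {d n : ℕ} (v : Fin n → ℝ)
    (M : Fin n → Matrix (Fin d) (Fin d) ℝ) :
    frobInner (∑ i, v i • M i) (∑ i, v i • M i) =
      ∑ i, ∑ j, v i * v j * frobInner (M i) (M j) := by
  simp only [frobInner, Matrix.sum_apply, Matrix.smul_apply, smul_eq_mul, Finset.sum_mul_sum]
  have hcomm (f : Fin d → Fin d → Fin n → Fin n → ℝ) :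
      ∑ r, ∑ s, ∑ i, ∑ j, f r s i j = ∑ i, ∑ j, ∑ r, ∑ s, f r s i j := by
    calc _ = ∑ r, ∑ i, ∑ s, ∑ j, f r s i j := Finset.sum_congr rfl fun _ _ => Finset.sum_comm
      _ = ∑ i, ∑ r, ∑ s, ∑ j, f r s i j := Finset.sum_comm
      _ = ∑ i, ∑ r, ∑ j, ∑ s, f r s i j := Finset.sum_congr rfl fun _ _ =>
        Finset.sum_congr rfl fun _ _ => Finset.sum_comm
      _ = _ := Finset.sum_congr rfl fun _ _ => Finset.sum_comm
  rw [hcomm]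
  simp only [Finset.mul_sum]
  refine Finset.sum_congr rfl fun i _ => Finset.sum_congr rfl fun j _ =>
    Finset.sum_congr rfl fun r _ => Finset.sum_congr rfl fun s _ => ?_
  ring

section Integrability

variable {Ω : Type*} [MeasurableSpace Ω] {μ : Measure Ω} {d n : ℕ}

lemma integrable_frobInner {F H : Ω → Matrix (Fin d) (Fin d) ℝ}
    (hF : ∀ r s, MemLp (fun ω => F ω r s) 2 μ) (hH : ∀ r s, MemLp (fun ω => H ω r s) 2 μ) :
    Integrable (fun ω => frobInner (F ω) (H ω)) μ :=
  integrable_finsetSum _ fun r _ => integrable_finsetSum _ fun s _ =>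
    (hF r s).integrable_mul (hH r s)

lemma memLp_two_entry {F : Ω → Matrix (Fin d) (Fin d) ℝ}
    (hF : ∀ r s, Measurable fun ω => F ω r s)
    (hint : Integrable (fun ω => frobInner (F ω) (F ω)) μ) (r s : Fin d) :
    MemLp (fun ω => F ω r s) 2 μ := by
  rw [memLp_two_iff_integrable_sq (hF r s).aestronglyMeasurable]
  refine hint.mono' ((hF r s).pow_const 2).aestronglyMeasurable (ae_of_all _ fun ω => ?_)
  rw [Real.norm_of_nonneg (sq_nonneg _)]
  exact sq_entry_le_frobInner_self _ r s

lemma memLp_two_symPart_entry {F : Ω → Matrix (Fin d) (Fin d) ℝ}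
    (hF : ∀ r s, MemLp (fun ω => F ω r s) 2 μ) (r s : Fin d) :
    MemLp (fun ω => symPart (F ω) r s) 2 μ :=
  ((hF r s).add (hF s r)).const_mul 2⁻¹

lemma memLp_two_sum_smul_entry {F : Fin n → Ω → Matrix (Fin d) (Fin d) ℝ}
    (hF : ∀ i r s, MemLp (fun ω => F i ω r s) 2 μ) (v : Fin n → ℝ) (r s : Fin d) :
    MemLp (fun ω => (∑ i, v i • F i ω) r s) 2 μ := by
  simp only [Matrix.sum_apply, Matrix.smul_apply, smul_eq_mul]
  exact memLp_finsetSum _ fun i _ => (hF i r s).const_mul (v i)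

lemma integrable_mul_of_ae_bounds {w f : Ω → ℝ} {a b : ℝ} (hw : Measurable w)
    (hbd : ∀ᵐ ω ∂μ, a ≤ w ω ∧ w ω ≤ b) (hf : Integrable f μ) :
    Integrable (fun ω => w ω * f ω) μ := by
  refine hf.bdd_mul (c := max |a| |b|) hw.aestronglyMeasurable ?_
  filter_upwards [hbd] with ω hω
  exact abs_le_max_abs_abs hω.1 hω.2

lemma mul_integral_le_integral_weight_mul {w f : Ω → ℝ} {a b : ℝ} (hw : Measurable w)
    (hbd : ∀ᵐ ω ∂μ, a ≤ w ω ∧ w ω ≤ b) (hf : Integrable f μ) (hf₀ : ∀ ω, 0 ≤ f ω) :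
    a * ∫ ω, f ω ∂μ ≤ ∫ ω, w ω * f ω ∂μ := by
  rw [← integral_const_mul]
  refine integral_mono_ae (hf.const_mul a) (integrable_mul_of_ae_bounds hw hbd hf) ?_
  filter_upwards [hbd] with ω hω
  exact mul_le_mul_of_nonneg_right hω.1 (hf₀ ω)

lemma integral_weight_mul_le_mul_integral {w f : Ω → ℝ} {a b : ℝ} (hw : Measurable w)
    (hbd : ∀ᵐ ω ∂μ, a ≤ w ω ∧ w ω ≤ b) (hf : Integrable f μ) (hf₀ : ∀ ω, 0 ≤ f ω) :
    ∫ ω, w ω * f ω ∂μ ≤ b * ∫ ω, f ω ∂μ := by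
  rw [← integral_const_mul]
  refine integral_mono_ae (integrable_mul_of_ae_bounds hw hbd hf) (hf.const_mul b) ?_
  filter_upwards [hbd] with ω hω
  exact mul_le_mul_of_nonneg_right hω.2 (hf₀ ω)

/-- The quadratic form of a weighted Gram matrix is the weighted integral of the squared
Frobenius norm of the corresponding linear combination. -/
lemma dotProduct_gram_mulVec {F : Fin n → Ω → Matrix (Fin d) (Fin d) ℝ} {w : Ω → ℝ} {a b : ℝ}
    (hF : ∀ i r s, MemLp (fun ω => F i ω r s) 2 μ) (hw : Measurable w)
    (hbd : ∀ᵐ ω ∂μ, a ≤ w ω ∧ w ω ≤ b) {B : Matrix (Fin n) (Fin n) ℝ}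
    (hB : ∀ i j, B i j = ∫ ω, w ω * frobInner (F i ω) (F j ω) ∂μ) (x : Fin n → ℝ) :
    x ⬝ᵥ B *ᵥ x =
      ∫ ω, w ω * frobInner (∑ i, x i • F i ω) (∑ i, x i • F i ω) ∂μ := by
  have hint (i j : Fin n) :
      Integrable (fun ω => x i * x j * (w ω * frobInner (F i ω) (F j ω))) μ :=
    (integrable_mul_of_ae_bounds hw hbd (integrable_frobInner (hF i) (hF j))).const_mul _
  have hexp (ω : Ω) : w ω * frobInner (∑ i, x i • F i ω) (∑ i, x i • F i ω) =
      ∑ i, ∑ j, x i * x j * (w ω * frobInner (F i ω) (F j ω)) := by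
    rw [frobInner_sum_smul_self]
    simp only [Finset.mul_sum]
    exact Finset.sum_congr rfl fun i _ => Finset.sum_congr rfl fun j _ => by ring
  simp only [hexp]
  rw [integral_finsetSum _ fun i _ => integrable_finsetSum _ fun j _ => hint i j]
  simp only [dotProduct, mulVec, Finset.mul_sum]
  refine Finset.sum_congr rfl fun i _ => ?_
  rw [integral_finsetSum _ fun j _ => hint i j]
  refine Finset.sum_congr rfl fun j _ => ?_
  rw [integral_const_mul, hB]
  ring

end Integrability

lemma Matrix.IsSymm.dotProduct_mulVec_comm {n : ℕ} {B : Matrix (Fin n) (Fin n) ℝ}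
    (hB : B.IsSymm) (x y : Fin n → ℝ) : x ⬝ᵥ B *ᵥ y = y ⬝ᵥ B *ᵥ x := by
  rw [dotProduct_mulVec, dotProduct_comm, ← mulVec_transpose, hB.eq]

/-- An eigenvalue of `B⁻¹ * A`, with `A` symmetric and `B` positive definite, is real and is the
generalized Rayleigh quotient of a nonzero real vector. -/
lemma Matrix.PosDef.exists_eq_rayleigh {n : ℕ} {A B : Matrix (Fin n) (Fin n) ℝ}
    (hA : A.IsSymm) (hB : B.PosDef) {lam : ℂ} {v : Fin n → ℂ} (hv : v ≠ 0)
    (heig : ((B⁻¹ * A).map Complex.ofReal).mulVec v = lam • v) :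
    lam.im = 0 ∧ ∃ x : Fin n → ℝ, 0 < x ⬝ᵥ B *ᵥ x ∧ x ⬝ᵥ A *ᵥ x = lam.re * (x ⬝ᵥ B *ᵥ x) := by
  set x : Fin n → ℝ := fun i => (v i).re with hx
  set y : Fin n → ℝ := fun i => (v i).im with hy
  have hunit : IsUnit B.det := hB.det_pos.ne'.isUnit
  have hBsymm : B.IsSymm := by simpa [Matrix.IsHermitian, Matrix.IsSymm] using hB.isHermitian
  have hre : (B⁻¹ * A) *ᵥ x = lam.re • x - lam.im • y := by
    ext i
    have h := congrArg Complex.re (congrFun heig i)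
    simpa [mulVec, dotProduct, hx, hy] using h
  have him : (B⁻¹ * A) *ᵥ y = lam.re • y + lam.im • x := by
    ext i
    have h := congrArg Complex.im (congrFun heig i)
    simpa [mulVec, dotProduct, hx, hy] using h
  have hAx : A *ᵥ x = lam.re • B *ᵥ x - lam.im • B *ᵥ y := by
    have h := congrArg (B *ᵥ ·) hre
    simpa [mulVec_mulVec, mul_nonsing_inv_cancel_left _ _ hunit, mulVec_sub, mulVec_smul] using h
  have hAy : A *ᵥ y = lam.re • B *ᵥ y + lam.im • B *ᵥ x := by
    have h := congrArg (B *ᵥ ·) him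
    simpa [mulVec_mulVec, mul_nonsing_inv_cancel_left _ _ hunit, mulVec_add, mulVec_smul] using h
  have hpos {z : Fin n → ℝ} (hz : z ≠ 0) : 0 < z ⬝ᵥ B *ᵥ z := by
    simpa using hB.dotProduct_mulVec_pos hz
  have hnonneg (z : Fin n → ℝ) : 0 ≤ z ⬝ᵥ B *ᵥ z := by
    rcases eq_or_ne z 0 with rfl | hz
    · simp
    · exact (hpos hz).le
  have hxy : x ≠ 0 ∨ y ≠ 0 := by
    by_contra! h
    exact hv (funext fun i => Complex.ext (congrFun h.1 i) (congrFun h.2 i))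
  have hsum : 0 < x ⬝ᵥ B *ᵥ x + y ⬝ᵥ B *ᵥ y := by
    rcases hxy with h | h
    · exact add_pos_of_pos_of_nonneg (hpos h) (hnonneg y)
    · exact add_pos_of_nonneg_of_pos (hnonneg x) (hpos h)
  have hzero : lam.im = 0 := by
    have h := hA.dotProduct_mulVec_comm x y
    have h' := hBsymm.dotProduct_mulVec_comm x y
    rw [hAx, hAy] at h
    simp only [dotProduct_add, dotProduct_sub, dotProduct_smul, smul_eq_mul] at h
    rw [h'] at h
    have : lam.im * (x ⬝ᵥ B *ᵥ x + y ⬝ᵥ B *ᵥ y) = 0 := by linarith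
    exact (mul_eq_zero.mp this).resolve_right hsum.ne'
  refine ⟨hzero, ?_⟩
  rcases hxy with h | h
  · exact ⟨x, hpos h, by rw [hAx, hzero]; simp⟩
  · exact ⟨y, hpos h, by rw [hAy, hzero]; simp⟩


theorem stmt11 {Ω : Type*} [MeasurableSpace Ω] (μ : Measure Ω)
    (d n : ℕ) (hd : 1 ≤ d)
    (G : Fin n → Ω → Matrix (Fin d) (Fin d) ℝ)
    (hG : ∀ i r s, Measurable fun ω => G i ω r s)
    (hGint : ∀ i, Integrable (fun ω => frobInner (G i ω) (G i ω)) μ)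
    (E e₀ : Ω → ℝ) (hE : Measurable E) (he₀ : Measurable e₀)
    (Emin Emax e₀min e₀max : ℝ) (hEmin : 0 < Emin) (he₀min : 0 < e₀min)
    (hbdE : ∀ᵐ ω ∂μ, Emin ≤ E ω ∧ E ω ≤ Emax)
    (hbde₀ : ∀ᵐ ω ∂μ, e₀min ≤ e₀ ω ∧ e₀ ω ≤ e₀max)
    (CK : ℝ) (hCK : 0 < CK) (hCK1 : CK ≤ 1)
    -- the Korn-type inequality
    (hKorn : ∀ v : Fin n → ℝ,
      CK * ∫ ω, frobInner (∑ i, v i • G i ω) (∑ i, v i • G i ω) ∂μ ≤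
        ∫ ω, frobInner (symPart (∑ i, v i • G i ω)) (symPart (∑ i, v i • G i ω)) ∂μ)
    (A Atil : Matrix (Fin n) (Fin n) ℝ)
    (hA : ∀ i j, A i j = ∫ ω, E ω * frobInner (symPart (G i ω)) (symPart (G j ω)) ∂μ)
    (hAtil : ∀ i j, Atil i j = ∫ ω, e₀ ω * frobInner (G i ω) (G j ω) ∂μ)
    (hpd : Atil.PosDef)
    (lam : ℂ) (v : Fin n → ℂ) (hv : v ≠ 0)
    (heig : ((Atil⁻¹ * A).map Complex.ofReal).mulVec v = lam • v) :
    lam.im = 0 ∧ CK * Emin / e₀max ≤ lam.re ∧ lam.re ≤ Emax / e₀min := by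
  have hL2 (i r s) : MemLp (fun ω => G i ω r s) 2 μ := memLp_two_entry (hG i) (hGint i) r s
  have hL2sym (i r s) : MemLp (fun ω => symPart (G i ω) r s) 2 μ :=
    memLp_two_symPart_entry (hL2 i) r s
  have hAsymm : A.IsSymm := Matrix.IsSymm.ext fun i j => by
    rw [hA, hA]
    simp only [frobInner_comm]
  obtain ⟨him, x, hpos, hray⟩ := hpd.exists_eq_rayleigh hAsymm hv heig
  have hμ : (ae μ).NeBot := by
    rw [ae_neBot]
    rintro rfl
    rw [dotProduct_gram_mulVec hL2 he₀ hbde₀ hAtil, integral_zero_measure] at hpos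
    exact hpos.false
  obtain ⟨ω₀, ⟨hE₁, hE₂⟩, he₁, he₂⟩ := (hbdE.and hbde₀).exists
  have hEmax : 0 < Emax := by linarith
  have he₀max : 0 < e₀max := by linarith
  rw [dotProduct_gram_mulVec hL2sym hE hbdE hA, dotProduct_gram_mulVec hL2 he₀ hbde₀ hAtil]
    at hray
  rw [dotProduct_gram_mulVec hL2 he₀ hbde₀ hAtil] at hpos
  simp only [← symPart_sum_smul] at hray
  have hLx := memLp_two_sum_smul_entry hL2 x
  have hint := integrable_frobInner hLx hLx
  have hLxsym := memLp_two_symPart_entry hLx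
  have hintsym := integrable_frobInner hLxsym hLxsym
  have hElow := mul_integral_le_integral_weight_mul hE hbdE hintsym
    fun _ => frobInner_self_nonneg _
  have hEup := integral_weight_mul_le_mul_integral hE hbdE hintsym
    fun _ => frobInner_self_nonneg _
  have helow := mul_integral_le_integral_weight_mul he₀ hbde₀ hint
    fun _ => frobInner_self_nonneg _
  have heup := integral_weight_mul_le_mul_integral he₀ hbde₀ hint
    fun _ => frobInner_self_nonneg _
  have hsym := integral_mono hintsym hint fun _ => frobInner_symPart_self_le _
  have hK := hKorn x
  rw [hray] at hElow hEup
  generalize (∫ ω, e₀ ω * frobInner (∑ i, x i • G i ω) (∑ i, x i • G i ω) ∂μ) = q at *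
  generalize (∫ ω, frobInner (∑ i, x i • G i ω) (∑ i, x i • G i ω) ∂μ) = g at *
  generalize (∫ ω, frobInner (symPart (∑ i, x i • G i ω)) (symPart (∑ i, x i • G i ω)) ∂μ) = s at *
  refine ⟨him, ?_, ?_⟩
  · rw [div_le_iff₀ he₀max]
    refine le_of_mul_le_mul_right ?_ hpos
    calc CK * Emin * q ≤ CK * Emin * (e₀max * g) := by gcongr
      _ = Emin * (CK * g) * e₀max := by ring
      _ ≤ Emin * s * e₀max := by gcongr
      _ ≤ lam.re * q * e₀max := by gcongr
      _ = lam.re * e₀max * q := by ring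
  · rw [le_div_iff₀ he₀min]
    refine le_of_mul_le_mul_right ?_ hpos
    calc lam.re * e₀min * q = lam.re * q * e₀min := by ring
      _ ≤ Emax * s * e₀min := by gcongr
      _ ≤ Emax * g * e₀min := by gcongr
      _ = Emax * (e₀min * g) := by ring
      _ ≤ Emax * q := by gcongr
end

section
/- Let A be a real symmetric n × n matrix, B a real m × n matrix, P_A a real symmetric positive definite n × n matrix and P_S a real symmetric positive definite m × m matrix. Suppose there are constants 0 < μ_min ≤ μ_max with μ_min vᵀ P_A v ≤ vᵀ A v ≤ μ_max vᵀ P_A v for all v ∈ ℝⁿ, and constants 0 < θ ≤ Θ with θ² wᵀ P_S w ≤ wᵀ B P_A⁻¹ Bᵀ w ≤ Θ² wᵀ P_S w for all w ∈ ℝ^m. Let P = blockdiag(P_A, P_S) and let K = [[A, Bᵀ], [B, 0]] be the (n+m) × (n+m) saddle point matrix. Then every eigenvalue λ of the symmetric matrix P^{−1/2} K P^{−1/2} lies in the union of intervals [ (1/2)(μ_min − √(μ_min² + 4Θ²)), (1/2)(μ_max − √(μ_max² + 4θ²)) ] ∪ [ μ_min, (1/2)(μ_max + √(μ_max² + 4Θ²))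 ]. -/
open Matrix

/-- Expansion of a symmetric quadratic form along a line. -/
lemma dotProduct_mulVec_sub_smul {n : Type*} [Fintype n] {M : Matrix n n ℝ} (hM : M.IsSymm)
    (z x : n → ℝ) (t : ℝ) :
    (z - t • x) ⬝ᵥ M *ᵥ (z - t • x) =
      z ⬝ᵥ M *ᵥ z - 2 * t * (z ⬝ᵥ M *ᵥ x) + t ^ 2 * (x ⬝ᵥ M *ᵥ x) := by
  have hsymm : x ⬝ᵥ M *ᵥ z = z ⬝ᵥ M *ᵥ x := by
    rw [dotProduct_mulVec, ← mulVec_transpose, hM.eq, dotProduct_comm]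
  simp only [mulVec_sub, mulVec_smul, sub_dotProduct, dotProduct_sub, smul_dotProduct,
    dotProduct_smul, smul_eq_mul, hsymm]
  ring

/-- Bounds for the eigenvalues of a saddle point pencil, where `z` satisfies `PA z = Bᵀ y`. -/
lemma saddle_point_quadratic_bounds {n m : Type*} [Fintype n] [Fintype m]
    {A PA : Matrix n n ℝ} (hA : A.IsSymm) (hPA : PA.PosDef)
    {B : Matrix m n ℝ} {PS : Matrix m m ℝ} (hPS : PS.PosDef)
    {μmin μmax θ Θ lam : ℝ} (hμ0 : 0 < μmin) (hθ0 : 0 < θ) (hΘ0 : 0 < Θ)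
    (hAbd : ∀ v : n → ℝ,
      μmin * (v ⬝ᵥ PA *ᵥ v) ≤ v ⬝ᵥ A *ᵥ v ∧ v ⬝ᵥ A *ᵥ v ≤ μmax * (v ⬝ᵥ PA *ᵥ v))
    {x z : n → ℝ} {y : m → ℝ} (hxy : x ≠ 0 ∨ y ≠ 0)
    (hz : PA *ᵥ z = Bᵀ *ᵥ y)
    (hlow : θ ^ 2 * (y ⬝ᵥ PS *ᵥ y) ≤ z ⬝ᵥ PA *ᵥ z)
    (hupp : z ⬝ᵥ PA *ᵥ z ≤ Θ ^ 2 * (y ⬝ᵥ PS *ᵥ y))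
    (h₁ : A *ᵥ x + Bᵀ *ᵥ y = lam • PA *ᵥ x) (h₂ : B *ᵥ x = lam • PS *ᵥ y) :
    (lam < 0 ∧ lam ^ 2 - μmin * lam ≤ Θ ^ 2 ∧ θ ^ 2 ≤ lam ^ 2 - μmax * lam) ∨
      (μmin ≤ lam ∧ lam ^ 2 - μmax * lam ≤ Θ ^ 2) := by
  have hPAs : PA.IsSymm := by simpa using hPA.isHermitian
  have hnonneg (u : n → ℝ) : 0 ≤ u ⬝ᵥ PA *ᵥ u := by
    simpa using hPA.posSemidef.dotProduct_mulVec_nonneg u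
  have hys : 0 ≤ y ⬝ᵥ PS *ᵥ y := by
    simpa using hPS.posSemidef.dotProduct_mulVec_nonneg y
  have hzx : z ⬝ᵥ PA *ᵥ x = lam * (y ⬝ᵥ PS *ᵥ y) := by
    rw [dotProduct_mulVec, ← mulVec_transpose, hPAs.eq, hz, mulVec_transpose,
      ← dotProduct_mulVec, h₂, dotProduct_smul, smul_eq_mul]
  have hxz : x ⬝ᵥ PA *ᵥ z = lam * (y ⬝ᵥ PS *ᵥ y) := by
    rw [dotProduct_mulVec, ← mulVec_transpose, hPAs.eq, dotProduct_comm, hzx]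
  have hAx : A *ᵥ x = lam • PA *ᵥ x - PA *ᵥ z := by rw [hz, ← h₁, add_sub_cancel_right]
  have hxAx : x ⬝ᵥ A *ᵥ x = lam * (x ⬝ᵥ PA *ᵥ x) - lam * (y ⬝ᵥ PS *ᵥ y) := by
    rw [hAx, dotProduct_sub, dotProduct_smul, smul_eq_mul, hxz]
  have hzAx : z ⬝ᵥ A *ᵥ x = lam * (lam * (y ⬝ᵥ PS *ᵥ y)) - z ⬝ᵥ PA *ᵥ z := by
    rw [hAx, dotProduct_sub, dotProduct_smul, smul_eq_mul, hzx]
  have hx : x ≠ 0 := by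
    rintro rfl
    have hy : y ≠ 0 := by simpa using hxy
    have hPz : PA *ᵥ z = 0 := by simpa using hAx
    rw [hPz, dotProduct_zero] at hlow
    have : 0 < y ⬝ᵥ PS *ᵥ y := by simpa using hPS.dotProduct_mulVec_pos hy
    nlinarith [mul_pos (pow_pos hθ0 2) this]
  have hxp : 0 < x ⬝ᵥ PA *ᵥ x := by simpa using hPA.dotProduct_mulVec_pos hx
  have hline (t : ℝ) := hnonneg (z - t • x)
  have hAline := hAbd (z - (lam - μmax) • x)
  have hAz := hAbd z
  obtain ⟨hx₁, hx₂⟩ := hAbd x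
  simp only [dotProduct_mulVec_sub_smul hPAs, dotProduct_mulVec_sub_smul hA, hzx, hzAx]
    at hline hAline
  rw [hxAx] at hx₁ hx₂ hAline
  generalize x ⬝ᵥ PA *ᵥ x = a at *
  generalize y ⬝ᵥ PS *ᵥ y = s at *
  generalize z ⬝ᵥ PA *ᵥ z = q at *
  generalize z ⬝ᵥ A *ᵥ z = r at *
  have hlam : lam ≠ 0 := by
    rintro rfl
    nlinarith [mul_pos hμ0 hxp]
  have hsa : lam ^ 2 * s ≤ Θ ^ 2 * a := by
    obtain ⟨t, ht⟩ : ∃ t, t * lam = Θ ^ 2 := ⟨Θ ^ 2 / lam, div_mul_cancel₀ _ hlam⟩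
    have hts : Θ ^ 2 * s ≤ t ^ 2 * a := by
      have := hline t
      rw [show 2 * t * (lam * s) = 2 * (t * lam) * s by ring, ht] at this
      linarith
    refine le_of_mul_le_mul_left ?_ (pow_pos hΘ0 2)
    calc Θ ^ 2 * (lam ^ 2 * s) = lam ^ 2 * (Θ ^ 2 * s) := by ring
      _ ≤ lam ^ 2 * (t ^ 2 * a) := by gcongr
      _ = (t * lam) ^ 2 * a := by ring
      _ = Θ ^ 2 * (Θ ^ 2 * a) := by rw [ht]; ring
  rcases hlam.lt_or_gt with hneg | hlampos
  · left
    have hspos : 0 < s := by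
      refine hys.lt_of_ne' ?_
      rintro rfl
      nlinarith [mul_pos hμ0 hxp, mul_pos (neg_pos.2 hneg) hxp]
    refine ⟨hneg, ?_, ?_⟩
    · refine le_of_mul_le_mul_right ?_ hxp
      nlinarith [mul_le_mul_of_nonneg_left hx₁ (neg_pos.2 hneg).le]
    · refine le_of_mul_le_mul_right ?_ hspos
      have hc : 0 < μmax - lam := by
        have : μmin ≤ μmax := le_of_mul_le_mul_right (hx₁.trans hx₂) hxp
        linarith
      have hq : q ≤ (μmax - lam) * (-lam * s) := by
        refine le_of_mul_le_mul_left ?_ hc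
        have hform := hline (lam - μmax)
        linarith [hAline.1, mul_nonneg hμ0.le hform, mul_nonneg (neg_pos.2 hneg).le hform, hAz.2]
      linarith
  · right
    constructor
    · refine le_of_mul_le_mul_right ?_ hxp
      nlinarith [mul_nonneg hlampos.le hys]
    · refine le_of_mul_le_mul_right ?_ hxp
      nlinarith [mul_le_mul_of_nonneg_left hx₂ hlampos.le]

theorem stmt15 {n m : ℕ}
    (A : Matrix (Fin n) (Fin n) ℝ) (hA : A.IsSymm)
    (B : Matrix (Fin m) (Fin n) ℝ)
    (PA : Matrix (Fin n) (Fin n) ℝ) (hPA : PA.PosDef)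
    (PS : Matrix (Fin m) (Fin m) ℝ) (hPS : PS.PosDef)
    (μmin μmax θ Θ : ℝ) (hμ0 : 0 < μmin) (hμ : μmin ≤ μmax)
    (hθ0 : 0 < θ) (hθΘ : θ ≤ Θ)
    (hAbd : ∀ v : Fin n → ℝ,
      μmin * (v ⬝ᵥ PA.mulVec v) ≤ v ⬝ᵥ A.mulVec v ∧
      v ⬝ᵥ A.mulVec v ≤ μmax * (v ⬝ᵥ PA.mulVec v))
    (hSbd : ∀ w : Fin m → ℝ,
      θ ^ 2 * (w ⬝ᵥ PS.mulVec w) ≤ w ⬝ᵥ (B * PA⁻¹ * Bᵀ).mulVec w ∧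
      w ⬝ᵥ (B * PA⁻¹ * Bᵀ).mulVec w ≤ Θ ^ 2 * (w ⬝ᵥ PS.mulVec w))
    -- S is the positive definite square root of P = blockdiag(PA, PS)
    (S : Matrix (Fin n ⊕ Fin m) (Fin n ⊕ Fin m) ℝ) (hS : S.PosDef)
    (hSsq : S * S = fromBlocks PA 0 0 PS)
    (lam : ℝ) (v : Fin n ⊕ Fin m → ℝ) (hv : v ≠ 0)
    (heig : (S⁻¹ * fromBlocks A Bᵀ B 0 * S⁻¹).mulVec v = lam • v) :
    lam ∈ Set.Icc ((μmin - Real.sqrt (μmin ^ 2 + 4 * Θ ^ 2)) / 2)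
        ((μmax - Real.sqrt (μmax ^ 2 + 4 * θ ^ 2)) / 2) ∪
      Set.Icc μmin ((μmax + Real.sqrt (μmax ^ 2 + 4 * Θ ^ 2)) / 2) := by
  have hSu : IsUnit S.det := hS.isUnit.map Matrix.detMonoidHom
  set u := S⁻¹ *ᵥ v with hu
  have hSuv : S *ᵥ u = v := by rw [hu, mulVec_mulVec, mul_nonsing_inv _ hSu, one_mulVec]
  have hu0 : u ≠ 0 := by
    intro h
    rw [h, mulVec_zero] at hSuv
    exact hv hSuv.symm
  have hpencil : fromBlocks A Bᵀ B 0 *ᵥ u = lam • fromBlocks PA 0 0 PS *ᵥ u := by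
    have := congrArg (S *ᵥ ·) heig
    simp only [mulVec_mulVec, mulVec_smul] at this
    rw [← hSsq, ← mulVec_mulVec, hSuv, ← this, hu, mulVec_mulVec, ← Matrix.mul_assoc,
      ← Matrix.mul_assoc, mul_nonsing_inv _ hSu, Matrix.one_mul]
  obtain ⟨x, y, hxyu⟩ : ∃ x y, u = Sum.elim x y := ⟨_, _, (Sum.elim_comp_inl_inr u).symm⟩
  rw [hxyu] at hpencil hu0
  have h₁ : A *ᵥ x + Bᵀ *ᵥ y = lam • PA *ᵥ x := by
    funext i
    simpa [fromBlocks_mulVec] using congrFun hpencil (Sum.inl i)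
  have h₂ : B *ᵥ x = lam • PS *ᵥ y := by
    funext i
    simpa [fromBlocks_mulVec] using congrFun hpencil (Sum.inr i)
  have hxy : x ≠ 0 ∨ y ≠ 0 := by
    by_contra! h
    exact hu0 (by rw [h.1, h.2]; exact Sum.elim_zero_zero)
  have hz : PA *ᵥ (PA⁻¹ *ᵥ (Bᵀ *ᵥ y)) = Bᵀ *ᵥ y := by
    rw [mulVec_mulVec, mul_nonsing_inv _ (hPA.isUnit.map Matrix.detMonoidHom), one_mulVec]
  have hschur : y ⬝ᵥ (B * PA⁻¹ * Bᵀ) *ᵥ y =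
      (PA⁻¹ *ᵥ (Bᵀ *ᵥ y)) ⬝ᵥ PA *ᵥ (PA⁻¹ *ᵥ (Bᵀ *ᵥ y)) := by
    rw [hz, ← mulVec_mulVec, ← mulVec_mulVec, dotProduct_mulVec, ← mulVec_transpose,
      dotProduct_comm]
  obtain ⟨hlow, hupp⟩ := hSbd y
  rw [hschur] at hlow hupp
  have hΘ0 : 0 < Θ := hθ0.trans_le hθΘ
  rcases saddle_point_quadratic_bounds hA hPA hPS hμ0 hθ0 hΘ0 hAbd hxy hz hlow hupp h₁ h₂ with
    ⟨hneg, hl, hr⟩ | ⟨hl, hr⟩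
  · left
    constructor
    · have := Real.abs_le_sqrt (x := 2 * lam - μmin) (y := μmin ^ 2 + 4 * Θ ^ 2) (by linarith)
      linarith [neg_abs_le (2 * lam - μmin)]
    · have : √(μmax ^ 2 + 4 * θ ^ 2) ≤ μmax - 2 * lam :=
        Real.sqrt_le_iff.2 ⟨by linarith, by linarith⟩
      linarith
  · right
    refine ⟨hl, ?_⟩
    have := Real.le_sqrt_of_sq_le (x := 2 * lam - μmax) (y := μmax ^ 2 + 4 * Θ ^ 2) (by linarith)
    linarith
end
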